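/- For all integers g ≥ 2 and n ≥ 2 and all nonnegative integers a_1, …, a_n with a_1 + ⋯ + a_n = 2g − 3 + n, the following identity holds in ℚ: 0 = Σ_{k=1}^{n} ((−1)^k (2g−3+k)!/k!) · Σ_{(I_1,…,I_k)} Σ_{(d_1,…,d_k)} Π_{j=1}^{k} [ binom(2·a_{[I_j]} + 1, 2·d_j) · Π_{i=1}^{|I_j|−1} (2·d_j + 1 − 2i) ], where the middle sum runs over all ordered tuples (I_1,…,I_k) of pairwise disjoint nonempty subsets of {1,…,n} whose union is {1,…,n}, and the inner sum runs over all tuples (d_1,…,d_k) of nonnegative integers with d_1 + ⋯ + d_k = g − 2 + n. -/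

import Mathlib

/-!
Statement 0.  For integers `g, n ≥ 2` and nonnegative integers `a_1, …, a_n` with
`a_1 + ⋯ + a_n = 2g - 3 + n`,
`0 = ∑_{k=1}^n ((-1)^k (2g-3+k)!/k!) ∑_{(I_1,…,I_k)} ∑_{(d_1,…,d_k)}
   ∏_{j=1}^k binom(2 a_{[I_j]} + 1, 2 d_j) ∏_{i=1}^{|I_j|-1} (2 d_j + 1 - 2 i)`,
where the middle sum runs over ordered tuples `(I_1,…,I_k)` of pairwise disjoint nonempty
subsets of `{1,…,n}` with union `{1,…,n}` and the inner sum over tuples `(d_1,…,d_k)` of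
nonnegative integers with `d_1 + ⋯ + d_k = g - 2 + n`.

Ordered tuples `(I_1,…,I_k)` of pairwise disjoint nonempty subsets of `{1,…,n}` whose union
is `{1,…,n}` correspond bijectively to surjections `f : Fin n → Fin k` via `I_j = f⁻¹(j)`;
the middle sum is encoded as a sum over surjective functions.  Tuples `(d_1,…,d_k)` of
nonnegative integers with sum `g - 2 + n` are encoded as the functions `Fin k → ℕ` in
`Fintype.piFinset (fun _ => Finset.range (g + n - 1))` whose values sum to `g + n - 2`
(any such tuple has all entries `≤ g + n - 2`, so none is omitted).
-/

open Finset

section Lagrange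

variable {S R ι : Type*} [CommRing S] [CommRing R] [Algebra S R]
  (D : Derivation S R R) (y : ι → S) (φ : ι → R)

/-- For `z = s + ∑ i ∈ J, y i * φ i (z)` with square-zero parameters `y i`, this is the Lagrange
expansion of `F(z) * dz/ds`. -/
def lagrangeDensity (J : Finset ι) (F : R) : R :=
  ∑ I ∈ J.powerset, (∏ i ∈ I, y i) • (D^[#I]) ((∏ i ∈ I, φ i) * F)

/-- For `z = s + ∑ i ∈ J, y i * φ i (z)` with square-zero parameters `y i`, this is the Lagrange
expansion of `G(z)`. -/
def lagrangeSubst (J : Finset ι) (G : R) : R :=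
  G + ∑ I ∈ J.powerset with I.Nonempty,
    (∏ i ∈ I, y i) • (D^[#I - 1]) ((∏ i ∈ I, φ i) * D G)

lemma iterate_derivation_smul (k : ℕ) (c : S) (x : R) : D^[k] (c • x) = c • D^[k] x := by
  induction k generalizing x with
  | zero => rfl
  | succ k ih => simp [ih]

lemma lagrangeDensity_add (J : Finset ι) (F G : R) :
    lagrangeDensity D y φ J (F + G) = lagrangeDensity D y φ J F + lagrangeDensity D y φ J G := by
  simp only [lagrangeDensity, ← sum_add_distrib, ← smul_add, mul_add, iterate_map_add]

lemma lagrangeDensity_empty (F : R) : lagrangeDensity D y φ ∅ F = F := by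
  simp [lagrangeDensity]

lemma lagrangeSubst_empty (G : R) : lagrangeSubst D y φ ∅ G = G := by
  simp [lagrangeSubst, filter_singleton]

variable [DecidableEq ι]

lemma lagrangeDensity_insert {J : Finset ι} {j : ι} (hj : j ∉ J) (F : R) :
    lagrangeDensity D y φ (insert j J) F =
      lagrangeDensity D y φ J F + y j • D (lagrangeDensity D y φ J (φ j * F)) := by
  simp only [lagrangeDensity, sum_powerset_insert hj, map_sum, smul_sum]
  congr 1
  refine sum_congr rfl fun I hI => ?_
  have hjI : j ∉ I := fun h => hj (mem_powerset.1 hI h)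
  rw [prod_insert hjI, prod_insert hjI, card_insert_of_notMem hjI, Function.iterate_succ_apply',
    D.map_smul, smul_smul]
  congr 3
  ring

lemma lagrangeSubst_insert {J : Finset ι} {j : ι} (hj : j ∉ J) (G : R) :
    lagrangeSubst D y φ (insert j J) G =
      lagrangeSubst D y φ J G + y j • lagrangeDensity D y φ J (φ j * D G) := by
  simp only [lagrangeSubst, lagrangeDensity, sum_filter, sum_powerset_insert hj, smul_sum,
    add_assoc]
  congr 2
  refine sum_congr rfl fun I hI => ?_
  have hjI : j ∉ I := fun h => hj (mem_powerset.1 hI h)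
  rw [prod_insert hjI, prod_insert hjI, card_insert_of_notMem hjI, if_pos (insert_nonempty j I),
    smul_smul, Nat.add_sub_cancel]
  congr 2
  ring

lemma derivation_lagrangeSubst (J : Finset ι) (G : R) :
    D (lagrangeSubst D y φ J G) = lagrangeDensity D y φ J (D G) := by
  induction J using Finset.induction_on with
  | empty => simp [lagrangeSubst_empty, lagrangeDensity_empty]
  | insert j J hj ih =>
    rw [lagrangeSubst_insert D y φ hj, lagrangeDensity_insert D y φ hj, map_add, ih, D.map_smul]

lemma lagrangeSubst_mul_lagrangeDensity (hy : ∀ i, y i * y i = 0) (J : Finset ι) (G F : R) :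
    lagrangeSubst D y φ J G * lagrangeDensity D y φ J F = lagrangeDensity D y φ J (G * F) := by
  induction J using Finset.induction_on generalizing G F with
  | empty => simp [lagrangeSubst_empty, lagrangeDensity_empty]
  | insert j J hj ih =>
    have hyj : algebraMap S R (y j) * algebraMap S R (y j) = 0 := by rw [← map_mul, hy, map_zero]
    have h1 : lagrangeDensity D y φ J (φ j * D G) * lagrangeDensity D y φ J F =
        D (lagrangeSubst D y φ J G) * lagrangeDensity D y φ J (φ j * F) := by
      rw [derivation_lagrangeSubst, ← ih, ← ih]; ring
    have h2 : D (lagrangeDensity D y φ J (φ j * (G * F))) =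
        lagrangeSubst D y φ J G * D (lagrangeDensity D y φ J (φ j * F)) +
        D (lagrangeSubst D y φ J G) * lagrangeDensity D y φ J (φ j * F) := by
      rw [show φ j * (G * F) = G * (φ j * F) by ring, ← ih, D.leibniz]
      simp only [smul_eq_mul]; ring
    rw [lagrangeSubst_insert D y φ hj, lagrangeDensity_insert D y φ hj,
      lagrangeDensity_insert D y φ hj, ← ih G F, h2]
    simp only [Algebra.smul_def]
    linear_combination (algebraMap S R (y j)) * h1 +
      lagrangeDensity D y φ J (φ j * D G) * D (lagrangeDensity D y φ J (φ j * F)) * hyj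

lemma lagrangeSubst_mul (hy : ∀ i, y i * y i = 0) (J : Finset ι) (G H : R) :
    lagrangeSubst D y φ J (G * H) = lagrangeSubst D y φ J G * lagrangeSubst D y φ J H := by
  induction J using Finset.induction_on with
  | empty => simp [lagrangeSubst_empty]
  | insert j J hj ih =>
    have hyj : algebraMap S R (y j) * algebraMap S R (y j) = 0 := by rw [← map_mul, hy, map_zero]
    have h : lagrangeDensity D y φ J (φ j * D (G * H)) =
        lagrangeSubst D y φ J G * lagrangeDensity D y φ J (φ j * D H) +
        lagrangeSubst D y φ J H * lagrangeDensity D y φ J (φ j * D G) := by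
      rw [lagrangeSubst_mul_lagrangeDensity D y φ hy, lagrangeSubst_mul_lagrangeDensity D y φ hy,
        ← lagrangeDensity_add, D.leibniz]
      simp only [smul_eq_mul]
      congr 1
      ring
    simp only [lagrangeSubst_insert D y φ hj, ih, h, Algebra.smul_def]
    linear_combination (-lagrangeDensity D y φ J (φ j * D G) *
      lagrangeDensity D y φ J (φ j * D H)) * hyj

lemma lagrangeSubst_of_derivation_eq_one (hy : ∀ i, y i * y i = 0) (J : Finset ι) {s : R}
    (hs : D s = 1) :
    lagrangeSubst D y φ J s = s + ∑ i ∈ J, y i • lagrangeSubst D y φ J (φ i) := by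
  induction J using Finset.induction_on with
  | empty => simp [lagrangeSubst_empty]
  | insert j J hj ih =>
    have hyj : algebraMap S R (y j) * algebraMap S R (y j) = 0 := by rw [← map_mul, hy, map_zero]
    have h1 : lagrangeDensity D y φ J 1 =
        1 + ∑ i ∈ J, y i • lagrangeDensity D y φ J (D (φ i)) := by
      rw [← hs, ← derivation_lagrangeSubst, ih]
      simp [derivation_lagrangeSubst]
    have h2 : lagrangeDensity D y φ J (φ j) = lagrangeSubst D y φ J (φ j) +
        ∑ i ∈ J, y i • lagrangeDensity D y φ J (φ j * D (φ i)) := by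
      rw [← mul_one (φ j), ← lagrangeSubst_mul_lagrangeDensity D y φ hy, h1, mul_one, mul_add,
        mul_one, mul_sum]
      simp_rw [mul_smul_comm, lagrangeSubst_mul_lagrangeDensity D y φ hy]
    rw [lagrangeSubst_insert D y φ hj, ih, sum_insert hj, hs, mul_one, h2,
      lagrangeSubst_insert D y φ hj]
    simp_rw [lagrangeSubst_insert D y φ hj, smul_add, sum_add_distrib, smul_sum, smul_smul, hy]
    simp only [zero_smul, add_zero, mul_comm (y j)]
    ring

end Lagrange

section Laurent

open LaurentPolynomial

variable {S : Type*} [CommRing S]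

/-- The derivative `d/dT` on Laurent polynomials as a linear map. -/
noncomputable def laurentDerivLinear (S : Type*) [CommRing S] : S[T;T⁻¹] →ₗ[S] S[T;T⁻¹] :=
  (Finsupp.lsum S fun k : ℤ => LinearMap.toSpanSingleton S S[T;T⁻¹] ((k : S[T;T⁻¹]) * T (k - 1))) ∘ₗ
    (AddMonoidAlgebra.coeffLinearEquiv S).toLinearMap

lemma laurentDerivLinear_C_mul_T (a : S) (k : ℤ) :
    laurentDerivLinear S (C a * T k) = C a * ((k : S[T;T⁻¹]) * T (k - 1)) := by
  rw [← single_eq_C_mul_T, laurentDerivLinear, LinearMap.comp_apply, LinearEquiv.coe_coe,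
    AddMonoidAlgebra.coeffLinearEquiv_apply, AddMonoidAlgebra.coeff_single, Finsupp.lsum_single,
    LinearMap.toSpanSingleton_apply, smul_eq_C_mul]

/-- The derivative `d/dT` on Laurent polynomials. -/
noncomputable def laurentDeriv (S : Type*) [CommRing S] :
    Derivation S S[T;T⁻¹] S[T;T⁻¹] :=
  Derivation.mk' (laurentDerivLinear S) fun f h => by
    induction f using LaurentPolynomial.induction_on' with
    | add f g hf hg => simp only [add_mul, map_add, hf, hg, smul_eq_mul]; ring
    | C_mul_T k a =>
      induction h using LaurentPolynomial.induction_on' with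
      | add f g hf hg => simp only [mul_add, map_add, hf, hg, smul_eq_mul]; ring
      | C_mul_T l b =>
        have h1 : (C a * T k) * (C b * T l) = C (a * b) * T (k + l) := by
          rw [map_mul, T_add]; ring
        have h2 : (T (k + l - 1) : S[T;T⁻¹]) = T k * T (l - 1) := by rw [← T_add]; congr 1; ring
        have h3 : (T (k + l - 1) : S[T;T⁻¹]) = T (k - 1) * T l := by rw [← T_add]; congr 1; ring
        rw [h1, laurentDerivLinear_C_mul_T, laurentDerivLinear_C_mul_T, laurentDerivLinear_C_mul_T,
          smul_eq_mul, smul_eq_mul, map_mul]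
        push_cast
        linear_combination (C a * C b * l) * h2 + (C a * C b * k) * h3

lemma laurentDeriv_C_mul_T (a : S) (k : ℤ) :
    laurentDeriv S (C a * T k) = C a * ((k : S[T;T⁻¹]) * T (k - 1)) :=
  laurentDerivLinear_C_mul_T a k

lemma laurentDeriv_T (k : ℤ) : laurentDeriv S (T k) = (k : S[T;T⁻¹]) * T (k - 1) := by
  simpa using laurentDeriv_C_mul_T (1 : S) k

lemma laurentDeriv_C (a : S) : laurentDeriv S (C a) = 0 := by
  simpa using laurentDeriv_C_mul_T a 0

lemma coeff_C_mul_T (a : S) (k m : ℤ) : (C a * T k).coeff m = if k = m then a else 0 := by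
  rw [← single_eq_C_mul_T, AddMonoidAlgebra.coeff_single, Finsupp.single_apply]

lemma coeff_C_mul (a : S) (f : S[T;T⁻¹]) (m : ℤ) : (C a * f).coeff m = a * f.coeff m := by
  rw [← smul_eq_C_mul]; simp

lemma coeff_mul_T (f : S[T;T⁻¹]) (k m : ℤ) : (f * T k).coeff m = f.coeff (m - k) := by
  induction f using LaurentPolynomial.induction_on' with
  | add f g hf hg => simp [add_mul, hf, hg]
  | C_mul_T l a =>
    rw [mul_assoc, ← T_add, coeff_C_mul_T, coeff_C_mul_T]
    exact if_congr (by omega) rfl rfl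

lemma coeff_neg_one_laurentDeriv (f : S[T;T⁻¹]) : (laurentDeriv S f).coeff (-1) = 0 := by
  induction f using LaurentPolynomial.induction_on' with
  | add f g hf hg => simp [hf, hg]
  | C_mul_T k a =>
    rw [laurentDeriv_C_mul_T, ← map_intCast (C : S →+* S[T;T⁻¹]), ← mul_assoc, ← map_mul,
      coeff_C_mul_T]
    split_ifs with h
    · obtain rfl : k = 0 := by omega
      simp
    · rfl

lemma derivation_unit_zpow {R : Type*} [CommRing R] [Algebra S R] (D : Derivation S R R)
    (t : Rˣ) (k : ℤ) : D ((t ^ k : Rˣ) : R) = (k : R) * ((t ^ (k - 1) : Rˣ) : R) * D t := by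
  have hinv : ((t⁻¹ : Rˣ) : R) * t = 1 := t.inv_mul
  induction k with
  | zero => simp
  | succ k ih =>
    have h : ((t ^ (k : ℤ) : Rˣ) : R) = ((t ^ ((k : ℤ) - 1) : Rˣ) : R) * t := by
      rw [← Units.val_mul, ← zpow_add_one]; simp
    rw [zpow_add_one, Units.val_mul, D.leibniz, ih, smul_eq_mul, smul_eq_mul, add_sub_cancel_right]
    push_cast at h ⊢
    linear_combination (-(k : R) * D t) * h
  | pred k ih =>
    have h : ((t ^ (-(k : ℤ)) : Rˣ) : R) = ((t ^ (-(k : ℤ) - 1) : Rˣ) : R) * t := by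
      rw [← Units.val_mul, ← zpow_add_one]; simp
    have h2 : ((t ^ (-(k : ℤ) - 1) : Rˣ) : R) = ((t ^ (-(k : ℤ) - 1 - 1) : Rˣ) : R) * t := by
      rw [← Units.val_mul, ← zpow_add_one]; simp
    have h3 := congrArg D h
    rw [D.leibniz, ih, smul_eq_mul, smul_eq_mul] at h3
    have h4 : D ((t ^ (-(k : ℤ) - 1) : Rˣ) : R) * t =
        ((-(k : ℤ) - 1 : ℤ) : R) * ((t ^ (-(k : ℤ) - 1 - 1) : Rˣ) : R) * D t * t := by
      push_cast at h3 ⊢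
      linear_combination -h3 + (-(k : R) - 1) * D t * h2
    exact t.isUnit.mul_left_injective h4

lemma laurentDeriv_eval₂ (t : S[T;T⁻¹]ˣ) (f : S[T;T⁻¹]) :
    laurentDeriv S (eval₂ C t f) = eval₂ C t (laurentDeriv S f) * laurentDeriv S t := by
  induction f using LaurentPolynomial.induction_on' with
  | add f g hf hg => simp only [map_add, hf, hg, add_mul]
  | C_mul_T k a =>
    rw [laurentDeriv_C_mul_T, eval₂_C_mul_T, map_mul (eval₂ C t), map_mul (eval₂ C t), map_intCast,
      eval₂_C, eval₂_T, ← smul_eq_C_mul, Derivation.map_smul, derivation_unit_zpow, smul_eq_C_mul]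
    ring

lemma exists_derivation_eq_log [Algebra ℚ S] {R : Type*} [CommRing R] [Algebra ℚ R] [Algebra S R]
    (D : Derivation S R R) {ν : R} (hν : IsNilpotent ν) : ∃ L, D L * (1 + ν) = D ν := by
  obtain ⟨M, hM⟩ := hν
  refine ⟨∑ k ∈ range M, ((-1 : ℚ) ^ k * ((k : ℚ) + 1)⁻¹) • ν ^ (k + 1), ?_⟩
  have h : D (∑ k ∈ range M, ((-1 : ℚ) ^ k * ((k : ℚ) + 1)⁻¹) • ν ^ (k + 1)) =
      (∑ k ∈ range M, (-ν) ^ k) * D ν := by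
    rw [map_sum, sum_mul]
    refine sum_congr rfl fun k _ => ?_
    have hk : ((k : ℚ) + 1) ≠ 0 := by positivity
    rw [map_rat_smul, D.leibniz_pow, ← Nat.cast_smul_eq_nsmul ℚ, smul_smul, neg_pow ν]
    rw [show (-1 : ℚ) ^ k * ((k : ℚ) + 1)⁻¹ * ((k + 1 : ℕ) : ℚ) = (-1) ^ k by
      push_cast; field_simp]
    rw [Nat.add_sub_cancel, smul_eq_mul, Algebra.smul_def]
    simp [mul_assoc]
  have hg : (∑ k ∈ range M, (-ν) ^ k) * (-ν - 1) = (-ν) ^ M - 1 := geom_sum_mul _ _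
  rw [neg_pow, hM] at hg
  rw [h]
  linear_combination -(D ν) * hg

/-- Invariance of the residue under a nilpotent perturbation of the coordinate. -/
lemma coeff_neg_one_eval₂_mul_laurentDeriv [Algebra ℚ S] (t : S[T;T⁻¹]ˣ) {ν : S[T;T⁻¹]}
    (hν : IsNilpotent ν) (ht : (t : S[T;T⁻¹]) = T 1 * (1 + ν)) (f : S[T;T⁻¹]) :
    (eval₂ C t f * laurentDeriv S t).coeff (-1) = f.coeff (-1) := by
  induction f using LaurentPolynomial.induction_on' with
  | add f g hf hg => simp [add_mul, hf, hg]
  | C_mul_T k a =>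
    rw [map_mul, eval₂_C, mul_assoc, coeff_C_mul, coeff_C_mul_T]
    split_ifs with hk
    · subst hk
      obtain ⟨L, hL⟩ := exists_derivation_eq_log (laurentDeriv S) hν
      have h1 : (T 1 * T (-1) : S[T;T⁻¹]) = 1 := by rw [← T_add]; simp
      have h2 : eval₂ C t (T (-1)) * laurentDeriv S t = T (-1) + laurentDeriv S L := by
        have h3 : laurentDeriv S (t : S[T;T⁻¹]) =
            (T (-1) + laurentDeriv S L) * (t : S[T;T⁻¹]) := by
          have h4 : laurentDeriv S (T 1) = 1 := by rw [laurentDeriv_T]; simp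
          rw [ht, Derivation.leibniz, map_add, h4, Derivation.map_one_eq_zero]
          simp only [smul_eq_mul]
          linear_combination -(T 1) * hL - (1 + ν) * h1
        rw [h3, eval₂_T]
        have : ((t ^ (-1 : ℤ) : S[T;T⁻¹]ˣ) : S[T;T⁻¹]) * t = 1 := by simp
        linear_combination (T (-1) + laurentDeriv S L) * this
      rw [h2, AddMonoidAlgebra.coeff_add, Finsupp.add_apply, coeff_neg_one_laurentDeriv]
      simp
    · have hk0 : ((k : ℚ) + 1) ≠ 0 := by
        intro h; apply hk; have : ((k + 1 : ℤ) : ℚ) = 0 := by push_cast; exact h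
        have := Int.cast_eq_zero.1 this; omega
      have h := coeff_neg_one_laurentDeriv (eval₂ C t (T (k + 1)))
      rw [laurentDeriv_eval₂, laurentDeriv_T, add_sub_cancel_right, map_mul, map_intCast,
        mul_assoc, ← map_intCast (C : S →+* S[T;T⁻¹]), coeff_C_mul] at h
      have h5 : ((k + 1 : ℤ) : ℚ) • (eval₂ C t (T k) * laurentDeriv S t).coeff (-1) = 0 := by
        rw [Algebra.smul_def]; simpa using h
      rcases smul_eq_zero.1 h5 with h6 | h6
      · exact absurd (by simpa using h6) hk0
      · rw [h6, mul_zero]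

end Laurent

section PowerSolution

open LaurentPolynomial

/-- The unit `2` of a `ℚ`-algebra. -/
def ratTwo (B : Type*) [CommRing B] [Algebra ℚ B] : Bˣ :=
  Units.map (algebraMap ℚ B : ℚ →* B) (Units.mk0 2 two_ne_zero)

lemma val_ratTwo_zpow {B : Type*} [CommRing B] [Algebra ℚ B] (k : ℤ) :
    ((ratTwo B ^ k : Bˣ) : B) = algebraMap ℚ B (2 ^ k) := by
  rw [ratTwo, ← map_zpow, Units.coe_map, Units.val_zpow_eq_zpow_val]
  rfl

lemma iterate_laurentDeriv_C_mul_T {B : Type*} [CommRing B] (m : ℕ) (b : B) (k : ℤ) :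
    (laurentDeriv B)^[m] (C b * T k) = C (b * ∏ j ∈ range m, ((k : B) - j)) * T (k - m) := by
  induction m with
  | zero => simp
  | succ m ih =>
    rw [Function.iterate_succ_apply', ih, laurentDeriv_C_mul_T, prod_range_succ,
      ← map_intCast (C : B →+* B[T;T⁻¹]), ← mul_assoc, ← map_mul, mul_assoc b]
    push_cast
    congr 2
    ring

/-- The Lagrange expansion of the solution of `π = 2 + ∑ y i * β i * π ^ e i`. -/
theorem exists_lagrange_power_solution {B ι : Type*} [CommRing B] [Algebra ℚ B] [Fintype ι]
    [DecidableEq ι] (y β : ι → B) (e : ι → ℤ) (hy : ∀ i, y i * y i = 0) :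
    ∃ (π : Bˣ) (w : B), (π : B) = 2 + ∑ i, y i * β i * (π ^ e i : Bˣ) ∧
      w = 1 + ∑ i, y i * β i * e i * (π ^ (e i - 1) : Bˣ) * w ∧
      ∀ k : ℤ, (π ^ k : Bˣ) * w = ∑ I : Finset ι, (∏ i ∈ I, y i) * (∏ i ∈ I, β i) *
        algebraMap ℚ B ((∏ j ∈ range #I, (((∑ i ∈ I, e i + k : ℤ) : ℚ) - j)) *
          2 ^ (∑ i ∈ I, e i + k - #I)) := by
  let D := laurentDeriv B
  let φ : ι → B[T;T⁻¹] := fun i => C (β i) * T (e i)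
  let ev : B[T;T⁻¹] →+* B := eval₂ (RingHom.id B) (ratTwo B)
  have hsmul (b : B) (f : B[T;T⁻¹]) : ev (b • f) = b * ev f := by
    rw [smul_eq_C_mul, map_mul, eval₂_C, RingHom.id_apply]
  have hΛC (b : B) (f : B[T;T⁻¹]) :
      lagrangeSubst D y φ univ (C b * f) = C b * lagrangeSubst D y φ univ f := by
    rw [← smul_eq_C_mul, ← smul_eq_C_mul]
    simp only [lagrangeSubst, D.map_smul, mul_smul_comm, iterate_derivation_smul, smul_add,
      smul_sum, smul_comm b]
  let h : Multiplicative ℤ →* B :=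
    { toFun := fun k => ev (lagrangeSubst D y φ univ (T k.toAdd))
      map_one' := by simp [lagrangeSubst]
      map_mul' := fun k l => by
        rw [toAdd_mul, T_add, lagrangeSubst_mul D y φ hy, map_mul] }
  let π : Bˣ := h.toHomUnits (Multiplicative.ofAdd 1)
  have hπ (k : ℤ) : ((π ^ k : Bˣ) : B) = ev (lagrangeSubst D y φ univ (T k)) := by
    rw [← map_zpow, ← ofAdd_zsmul, smul_eq_mul, mul_one]
    rfl
  have hDT : D (T 1) = 1 := by simp [D, laurentDeriv_T]
  have hw (k : ℤ) : ((π ^ k : Bˣ) : B) * ev (lagrangeDensity D y φ univ 1) =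
      ev (lagrangeDensity D y φ univ (T k)) := by
    rw [hπ, ← map_mul, lagrangeSubst_mul_lagrangeDensity D y φ hy, mul_one]
  refine ⟨π, ev (lagrangeDensity D y φ univ 1), ?_, ?_, fun k => ?_⟩
  · have h1 := lagrangeSubst_of_derivation_eq_one D y φ hy univ hDT
    rw [← zpow_one π, hπ, h1, map_add, map_sum]
    congr 1
    · rw [eval₂_T, val_ratTwo_zpow, zpow_one, map_ofNat]
    · refine sum_congr rfl fun i _ => ?_
      rw [hsmul, hΛC, map_mul, eval₂_C, RingHom.id_apply, zpow_one, hπ, mul_assoc]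
  · have h1 := congrArg D (lagrangeSubst_of_derivation_eq_one D y φ hy univ hDT)
    rw [derivation_lagrangeSubst, map_add, hDT, map_sum] at h1
    conv_lhs => rw [h1]
    rw [map_add, map_sum, map_one]
    congr 1
    refine sum_congr rfl fun i _ => ?_
    have h2 : lagrangeDensity D y φ univ (D (φ i)) =
        C (β i * e i) * lagrangeDensity D y φ univ (T (e i - 1)) := by
      rw [laurentDeriv_C_mul_T, ← map_intCast (C : B →+* B[T;T⁻¹]), ← mul_assoc, ← map_mul]
      rw [← smul_eq_C_mul, ← smul_eq_C_mul]
      simp only [lagrangeDensity, mul_smul_comm, iterate_derivation_smul, smul_sum,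
        smul_comm (β i * e i)]
    rw [D.map_smul, derivation_lagrangeSubst, hsmul, h2, map_mul, eval₂_C, RingHom.id_apply,
      mul_assoc _ _ (ev (lagrangeDensity D y φ univ 1)), hw]
    ring
  · rw [hw, lagrangeDensity, powerset_univ, map_sum]
    refine sum_congr rfl fun I _ => ?_
    have h3 : (∏ i ∈ I, φ i) * T k = C (∏ i ∈ I, β i) * T (∑ i ∈ I, e i + k) := by
      rw [T_add, prod_mul_distrib, map_prod, mul_assoc]
      congr 2
      induction I using Finset.induction_on with
      | empty => simp
      | insert j J hj ih => rw [prod_insert hj, sum_insert hj, T_add, ih (mem_univ J)]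
    rw [h3, hsmul, iterate_laurentDeriv_C_mul_T, map_mul, eval₂_C, eval₂_T, val_ratTwo_zpow,
      RingHom.id_apply, map_mul (algebraMap ℚ B), map_prod (algebraMap ℚ B)]
    simp [mul_assoc]

end PowerSolution

section PalindromicFactors

open LaurentPolynomial

lemma derivation_prod {S R ι : Type*} [CommRing S] [CommRing R] [Algebra S R] [DecidableEq ι]
    (D : Derivation S R R) (s : Finset ι) (f : ι → R) :
    D (∏ i ∈ s, f i) = ∑ j ∈ s, (∏ i ∈ s.erase j, f i) * D (f j) := by
  induction s using Finset.induction_on with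
  | empty => simp
  | insert k s hk ih =>
    rw [prod_insert hk, D.leibniz, ih, sum_insert hk, erase_insert hk, smul_eq_mul, smul_eq_mul,
      mul_sum, add_comm]
    congr 1
    refine sum_congr rfl fun j hj => ?_
    have hjk : j ≠ k := fun h => hk (h ▸ hj)
    rw [erase_insert_of_ne hjk.symm, prod_insert (fun h => hk (mem_of_mem_erase h)), mul_assoc]

/-- `(1 + x) / 2` -/
noncomputable def halfPlus : ℚ[T;T⁻¹] := C (1 / 2) * (1 + T 1)

/-- `(1 - x) / 2` -/
noncomputable def halfMinus : ℚ[T;T⁻¹] := C (1 / 2) * (1 - T 1)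

/-- `2 * (((1 + x) / 2) ^ (2 * a) - ((1 - x) / 2) ^ (2 * a)) / x` -/
noncomputable def diffFactor (a : ℕ) : ℚ[T;T⁻¹] :=
  2 * T (-1) * (halfPlus ^ (2 * a) - halfMinus ^ (2 * a))

/-- `diffFactor a / 2 - ((1 + x) / 2) ^ (2 * a) - ((1 - x) / 2) ^ (2 * a)` -/
noncomputable def sumFactor (a : ℕ) : ℚ[T;T⁻¹] :=
  T (-1) * (halfPlus ^ (2 * a) - halfMinus ^ (2 * a)) - (halfPlus ^ (2 * a) + halfMinus ^ (2 * a))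

lemma C_half_mul_two : (C (1 / 2) * 2 : ℚ[T;T⁻¹]) = 1 := by
  rw [← map_ofNat (C : ℚ →+* ℚ[T;T⁻¹]) 2, ← map_mul]; norm_num

lemma T_one_mul_T_neg_one {S : Type*} [CommRing S] : (T 1 * T (-1) : S[T;T⁻¹]) = 1 := by
  rw [← T_add]; simp

lemma laurentDeriv_halfPlus : laurentDeriv ℚ halfPlus = C (1 / 2) := by
  rw [halfPlus, ← smul_eq_C_mul, Derivation.map_smul, map_add, laurentDeriv_T]
  simp [smul_eq_C_mul]

lemma laurentDeriv_halfMinus : laurentDeriv ℚ halfMinus = -C (1 / 2) := by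
  rw [halfMinus, ← smul_eq_C_mul, Derivation.map_smul, map_sub, laurentDeriv_T]
  simp [smul_eq_C_mul]

lemma laurentDeriv_sumFactor (a : ℕ) :
    4 * (((a : ℕ) : ℚ[T;T⁻¹]) * sumFactor a - T 1 * laurentDeriv ℚ (sumFactor a)) =
      (1 + T 1 ^ 2) * (2 * ((a : ℕ) : ℚ[T;T⁻¹]) - 1) * diffFactor a -
        (3 + T 1 ^ 2) * T 1 * laurentDeriv ℚ (diffFactor a) := by
  rcases a with _ | b
  · simp [diffFactor, sumFactor]
  · have hT := T_one_mul_T_neg_one (S := ℚ)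
    have hC := C_half_mul_two
    have hD : laurentDeriv ℚ (T (-1)) = - (T (-1) * T (-1)) := by
      rw [laurentDeriv_T, ← T_add]; simp
    have h2 : laurentDeriv ℚ (2 : ℚ[T;T⁻¹]) = 0 := by
      rw [← map_ofNat (C : ℚ →+* ℚ[T;T⁻¹]) 2, laurentDeriv_C]
    have e1 : 2 * (b + 1) - 1 = 2 * b + 1 := by omega
    have e2 : halfPlus ^ (2 * (b + 1)) = halfPlus ^ (2 * b + 1) * halfPlus := by ring
    have e3 : halfMinus ^ (2 * (b + 1)) = halfMinus ^ (2 * b + 1) * halfMinus := by ring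
    simp only [sumFactor, diffFactor, map_sub, map_add, Derivation.leibniz, Derivation.leibniz_pow,
      laurentDeriv_halfPlus, laurentDeriv_halfMinus, hD, h2, smul_eq_mul, nsmul_eq_mul, e1]
    rw [e2, e3]
    generalize halfPlus ^ (2 * b + 1) = p
    generalize halfMinus ^ (2 * b + 1) = q
    simp only [halfPlus, halfMinus]
    push_cast
    generalize (T 1 : ℚ[T;T⁻¹]) = x at *
    generalize (T (-1) : ℚ[T;T⁻¹]) = z at *
    generalize (C (1 / 2) : ℚ[T;T⁻¹]) = c at *
    clear hD h2 e1 e2 e3 hC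
    grind

lemma invert_diffFactor (a : ℕ) :
    invert (diffFactor a) * T (2 * a - 2) = diffFactor a := by
  have h1 : invert halfPlus * T 1 = halfPlus := by
    simp only [halfPlus, map_mul, map_add, map_one, invert_C, invert_T]
    linear_combination (C (1 / 2)) * T_one_mul_T_neg_one (S := ℚ)
  have h2 : invert halfMinus * T 1 = -halfMinus := by
    simp only [halfMinus, map_mul, map_sub, map_one, invert_C, invert_T]
    linear_combination (-C (1 / 2)) * T_one_mul_T_neg_one (S := ℚ)
  have h3 : (T (2 * a - 2) : ℚ[T;T⁻¹]) = T 1 ^ (2 * a) * T (-1) * T (-1) := by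
    rw [T_pow, ← T_add, ← T_add]; congr 1; push_cast; ring
  rw [h3, diffFactor, map_mul, map_mul, map_sub, map_pow, map_pow, map_ofNat, invert_T, neg_neg]
  have h4 : invert halfPlus ^ (2 * a) * T 1 ^ (2 * a) = halfPlus ^ (2 * a) := by
    rw [← mul_pow, h1]
  have h5 : invert halfMinus ^ (2 * a) * T 1 ^ (2 * a) = halfMinus ^ (2 * a) := by
    rw [← mul_pow, h2, Even.neg_pow (even_two_mul a)]
  linear_combination (2 * T 1 * T (-1) * T (-1)) * (h4 - h5) +
    (2 * T (-1) * (halfPlus ^ (2 * a) - halfMinus ^ (2 * a))) * T_one_mul_T_neg_one (S := ℚ)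

lemma coeff_prod_diffFactor {ι : Type*} (s : Finset ι) (a : ι → ℕ) (m : ℤ) :
    (∏ i ∈ s, diffFactor (a i)).coeff (∑ i ∈ s, (2 * (a i : ℤ) - 2) - m) =
      (∏ i ∈ s, diffFactor (a i)).coeff m := by
  have h : invert (∏ i ∈ s, diffFactor (a i)) * T (∑ i ∈ s, (2 * (a i : ℤ) - 2)) =
      ∏ i ∈ s, diffFactor (a i) := by
    classical
    induction s using Finset.induction_on with
    | empty => simp
    | insert j s hj ih =>
      rw [prod_insert hj, sum_insert hj, T_add, map_mul]
      linear_combination ih * diffFactor (a j) +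
        invert (∏ i ∈ s, diffFactor (a i)) * T (∑ i ∈ s, (2 * (a i : ℤ) - 2)) *
          invert_diffFactor (a j)
  conv_rhs => rw [← h]
  rw [coeff_mul_T, invert_apply, neg_sub]

lemma coeff_neg_one_factor_expansion {ι : Type*} [Fintype ι] [DecidableEq ι] (a : ι → ℕ) (N : ℕ)
    (ha : ∑ i, a i = N + Fintype.card ι) :
    ((T (-(N + 1)) : ℚ[T;T⁻¹]) *
      ((Fintype.card ι - 1) * ((T 1 : ℚ[T;T⁻¹]) ^ 2 - 1) * laurentDeriv ℚ (∏ i, diffFactor (a i)) -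
        2 * N * (Fintype.card ι - 1) * (T 1 : ℚ[T;T⁻¹]) * ∏ i, diffFactor (a i) +
        4 * ∑ i, ((a i - N - 1) * laurentDeriv ℚ (sumFactor (a i)) *
              ∏ j ∈ univ.erase i, diffFactor (a j) +
            a i * sumFactor (a i) *
              laurentDeriv ℚ (∏ j ∈ univ.erase i, diffFactor (a j))))).coeff (-1) =
      0 := by
  set D := laurentDeriv ℚ
  set n : ℚ[T;T⁻¹] := ((Fintype.card ι : ℕ) : ℚ[T;T⁻¹]) with hn
  set β := ∏ i, diffFactor (a i) with hβ
  set β' : ι → ℚ[T;T⁻¹] := fun i => ∏ j ∈ univ.erase i, diffFactor (a j) with hβ'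
  have hT := T_one_mul_T_neg_one (S := ℚ)
  have hDN : D (T (-(N + 1))) =
      -((N : ℚ[T;T⁻¹]) + 1) * ((T (-(N + 1)) : ℚ[T;T⁻¹]) * (T (-1) : ℚ[T;T⁻¹])) := by
    rw [laurentDeriv_T, ← T_add]; push_cast; ring_nf
  have hD1 : D ((T 1 : ℚ[T;T⁻¹])) = 1 := by simp [D, laurentDeriv_T]
  have hnat (k : ℕ) : D (k : ℚ[T;T⁻¹]) = 0 := D.map_natCast k
  have hDβ : D β = ∑ i, β' i * D (diffFactor (a i)) := derivation_prod D univ _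
  have hmul (i : ι) : β' i * diffFactor (a i) = β := prod_erase_mul univ _ (mem_univ i)
  have hsum : ∑ i, (a i : ℚ[T;T⁻¹]) = N + n := by 
    rw [hn, ← Nat.cast_sum, ha, Nat.cast_add]
  have hkey : ∑ i, β' i * (4 * (((a i : ℕ) : ℚ[T;T⁻¹]) * sumFactor (a i) -
        (T 1 : ℚ[T;T⁻¹]) * D (sumFactor (a i)))) =
      (1 + (T 1 : ℚ[T;T⁻¹]) ^ 2) * (2 * N + n) * β -
        (3 + (T 1 : ℚ[T;T⁻¹]) ^ 2) * (T 1 : ℚ[T;T⁻¹]) * D β := by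
    have : ∀ i, β' i * (4 * (((a i : ℕ) : ℚ[T;T⁻¹]) * sumFactor (a i) -
        (T 1 : ℚ[T;T⁻¹]) * D (sumFactor (a i)))) =
        (1 + (T 1 : ℚ[T;T⁻¹]) ^ 2) * β * (2 * a i - 1) -
          (3 + (T 1 : ℚ[T;T⁻¹]) ^ 2) * (T 1 : ℚ[T;T⁻¹]) * (β' i * D (diffFactor (a i))) :=
      fun i => by
      rw [laurentDeriv_sumFactor, ← hmul i]; ring
    simp_rw [this]
    rw [sum_sub_distrib, ← mul_sum, ← mul_sum, ← hDβ, sum_sub_distrib, ← mul_sum, hsum]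
    simp [← hn]; ring
  have hE : (T (-(N + 1)) : ℚ[T;T⁻¹]) * ((n - 1) * ((T 1 : ℚ[T;T⁻¹]) ^ 2 - 1) * D β -
      2 * ((N : ℕ) : ℚ[T;T⁻¹]) * (n - 1) * (T 1 : ℚ[T;T⁻¹]) * β +
        4 * ∑ i, (((a i : ℕ) - N - 1 : ℚ[T;T⁻¹]) * D (sumFactor (a i)) * β' i +
          ((a i : ℕ) : ℚ[T;T⁻¹]) * sumFactor (a i) * D (β' i))) =
      D ((T (-(N + 1)) : ℚ[T;T⁻¹]) * (4 * ∑ i, ((a i : ℕ) : ℚ[T;T⁻¹]) * (sumFactor (a i) * β' i)) -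
        (T (-(N + 1)) : ℚ[T;T⁻¹]) * (((N + 1 : ℕ) * (3 + (T 1 : ℚ[T;T⁻¹]) ^ 2) -
          (n - 1) * ((T 1 : ℚ[T;T⁻¹]) ^ 2 - 1)) * β)) +
      C (((N + 1) * (N + 2) : ℕ) : ℚ) * (β * T (-N) - β * T (-N - 2)) := by
    have hsplit : ∑ i, (((a i : ℕ) - N - 1 : ℚ[T;T⁻¹]) * D (sumFactor (a i)) * β' i +
        ((a i : ℕ) : ℚ[T;T⁻¹]) * sumFactor (a i) * D (β' i)) =
        D (∑ i, ((a i : ℕ) : ℚ[T;T⁻¹]) * (sumFactor (a i) * β' i)) -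
          (N + 1) * ∑ i, D (sumFactor (a i)) * β' i := by
      rw [map_sum, mul_sum, ← sum_sub_distrib]
      refine sum_congr rfl fun i _ => ?_
      rw [D.leibniz, D.leibniz, hnat]
      simp only [smul_eq_mul]
      ring
    have hkey' : 4 * ∑ i, ((a i : ℕ) : ℚ[T;T⁻¹]) * (sumFactor (a i) * β' i) -
        4 * (T 1 : ℚ[T;T⁻¹]) * ∑ i, D (sumFactor (a i)) * β' i =
        (1 + (T 1 : ℚ[T;T⁻¹]) ^ 2) * (2 * N + n) * β -
          (3 + (T 1 : ℚ[T;T⁻¹]) ^ 2) * (T 1 : ℚ[T;T⁻¹]) * D β := by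
      rw [← hkey, mul_sum, mul_sum, ← sum_sub_distrib]
      exact sum_congr rfl fun i _ => by ring
    rw [hsplit]
    generalize ∑ i, ((a i : ℕ) : ℚ[T;T⁻¹]) * (sumFactor (a i) * β' i) = S₁ at hkey' ⊢
    generalize ∑ i, D (sumFactor (a i)) * β' i = S₂ at hkey' ⊢
    have h0 : (T (-N) : ℚ[T;T⁻¹]) = T (-(N + 1)) * T 1 := by rw [← T_add]; congr 1; ring
    have h2 : (T (-N - 2) : ℚ[T;T⁻¹]) = T (-(N + 1)) * T (-1) := by rw [← T_add]; congr 1; ring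
    have hD4 : D (4 : ℚ[T;T⁻¹]) = 0 := hnat 4
    have hD3 : D (3 : ℚ[T;T⁻¹]) = 0 := hnat 3
    have hDn : D n = 0 := hnat _
    rw [h0, h2, map_natCast]
    simp only [map_sub, map_add, D.leibniz, D.leibniz_pow, D.map_one_eq_zero, hDN, hnat, hD1, hD3,
      hD4, hDn, smul_eq_mul, nsmul_eq_mul]
    push_cast
    generalize (T (-(N + 1)) : ℚ[T;T⁻¹]) = v
    generalize D β = Dβ at hkey' ⊢
    generalize D S₁ = DS₁
    generalize (T 1 : ℚ[T;T⁻¹]) = x at hkey' hT ⊢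
    generalize (T (-1) : ℚ[T;T⁻¹]) = z at hT ⊢
    linear_combination (v * z * (N + 1)) * hkey' +
      (v * (N + 1) * (2 * n * x * β - (3 + x ^ 2) * Dβ + 4 * S₂ + (N - 2) * x * β)) * hT
  have hpal := coeff_prod_diffFactor univ a (N - 1)
  change (_ * (_ + 4 * ∑ i, (_ * β' i + _ * D (β' i)))).coeff (-1) = 0
  rw [hE, AddMonoidAlgebra.coeff_add, Finsupp.add_apply, coeff_neg_one_laurentDeriv, coeff_C_mul,
    AddMonoidAlgebra.coeff_sub, Finsupp.sub_apply, coeff_mul_T, coeff_mul_T, zero_add]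
  have h1 : ∑ i, (2 * (a i : ℤ) - 2) - (N - 1) = -1 - (-N - 2) := by
    have : ∑ i, (a i : ℤ) = N + Fintype.card ι := by exact_mod_cast ha
    rw [sum_sub_distrib, ← mul_sum, this]; simp; ring
  rw [h1] at hpal
  rw [hpal, show (-1 - -(N : ℤ)) = N - 1 by ring, sub_self, mul_zero]

end PalindromicFactors

section Coeffwise

open LaurentPolynomial

variable {A : Type*} [CommRing A] [Algebra ℚ A]

/-- Rational Laurent polynomials as Laurent polynomials over a `ℚ`-algebra. -/
noncomputable def ratLaurent (A : Type*) [CommRing A] [Algebra ℚ A] : ℚ[T;T⁻¹] →+* A[T;T⁻¹] :=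
  AddMonoidAlgebra.mapRingHom ℤ (algebraMap ℚ A)

lemma ratLaurent_C_mul_T (q : ℚ) (k : ℤ) :
    ratLaurent A (C q * T k) = C (algebraMap ℚ A q) * T k := by
  rw [← single_eq_C_mul_T, ratLaurent, AddMonoidAlgebra.mapRingHom_single, single_eq_C_mul_T]

lemma ratLaurent_C (q : ℚ) : ratLaurent A (C q) = C (algebraMap ℚ A q) := by
  have h := ratLaurent_C_mul_T (A := A) q 0
  rwa [T_zero, T_zero, mul_one, mul_one] at h

lemma ratLaurent_T (k : ℤ) : ratLaurent A (T k) = T k := by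
  simpa using ratLaurent_C_mul_T (A := A) 1 k

lemma laurentDeriv_ratLaurent (f : ℚ[T;T⁻¹]) :
    laurentDeriv A (ratLaurent A f) = ratLaurent A (laurentDeriv ℚ f) := by
  induction f using LaurentPolynomial.induction_on' with
  | add f g hf hg => simp only [map_add, hf, hg]
  | C_mul_T k a =>
    rw [ratLaurent_C_mul_T, laurentDeriv_C_mul_T, laurentDeriv_C_mul_T, map_mul, map_mul,
      map_intCast, ratLaurent_C, ratLaurent_T]

/-- Apply a linear functional to every coefficient of a Laurent polynomial. -/
noncomputable def coeffwise (ℓ : A →ₗ[ℚ] ℚ) : A[T;T⁻¹] →+ ℚ[T;T⁻¹] where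
  toFun := AddMonoidAlgebra.map ℓ.toAddMonoidHom
  map_zero' := AddMonoidAlgebra.map_zero _
  map_add' := AddMonoidAlgebra.map_add _

variable (ℓ : A →ₗ[ℚ] ℚ)

lemma coeff_coeffwise (f : A[T;T⁻¹]) (m : ℤ) : (coeffwise ℓ f).coeff m = ℓ (f.coeff m) := by
  simp [coeffwise]

lemma coeffwise_C_mul_T (b : A) (k : ℤ) : coeffwise ℓ (C b * T k) = C (ℓ b) * T k := by
  rw [← single_eq_C_mul_T, ← single_eq_C_mul_T]
  exact AddMonoidAlgebra.map_single _ _ _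

lemma coeffwise_C (b : A) : coeffwise ℓ (C b) = C (ℓ b) := by
  simpa using coeffwise_C_mul_T ℓ b 0

lemma coeffwise_ratLaurent_mul (g : ℚ[T;T⁻¹]) (f : A[T;T⁻¹]) :
    coeffwise ℓ (ratLaurent A g * f) = g * coeffwise ℓ f := by
  induction f using LaurentPolynomial.induction_on' with
  | add f h hf hh => simp only [mul_add, map_add, hf, hh]
  | C_mul_T k b =>
    induction g using LaurentPolynomial.induction_on' with
    | add f g hf hg => simp only [add_mul, map_add, hf, hg]
    | C_mul_T l q =>
      have h : ratLaurent A (C q * T l) * (C b * T k) = C (q • b) * T (l + k) := by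
        rw [ratLaurent_C_mul_T, T_add, Algebra.smul_def, map_mul]; ring
      rw [h, coeffwise_C_mul_T, coeffwise_C_mul_T, map_smul, smul_eq_mul, map_mul, T_add]
      ring

lemma algebraMap_laurent (q : ℚ) : algebraMap ℚ A[T;T⁻¹] q = ratLaurent A (C q) := by
  rw [ratLaurent_C]
  rfl

lemma prod_range_natCast_sub (m : ℕ) : ∏ j ∈ range m, ((m : ℚ) - j) = m.factorial := by
  rw [← prod_range_add_one_eq_factorial, ← prod_range_reflect, Nat.cast_prod]
  refine prod_congr rfl fun j hj => ?_
  have : j + (m - 1 - j) + 1 = m := by have := mem_range.1 hj; omega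
  have h2 : (j : ℚ) + ((m - 1 - j : ℕ) : ℚ) + 1 = m := by exact_mod_cast this
  push_cast
  linear_combination -h2

/-- Only the subset complementary to `K` contributes to the Lagrange expansion. -/
lemma coeffwise_prod_mul {ι : Type*} [Fintype ι] [DecidableEq ι] {y : ι → A}
    (hy : ∀ i, y i * y i = 0) (hℓ : ∀ I : Finset ι, ℓ (∏ i ∈ I, y i) = if I = univ then 1 else 0)
    (b : ι → ℚ[T;T⁻¹]) (e : ι → ℤ) {f : A[T;T⁻¹]} {k : ℤ} (K : Finset ι)
    (hf : f = ∑ I : Finset ι, (∏ i ∈ I, C (y i)) * (∏ i ∈ I, ratLaurent A (b i)) *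
        algebraMap ℚ A[T;T⁻¹] ((∏ j ∈ range #I, (((∑ i ∈ I, e i + k : ℤ) : ℚ) - j)) *
          2 ^ (∑ i ∈ I, e i + k - #I)))
    (hk : ∑ i ∈ Kᶜ, (e i - 1) + k = 0) :
    coeffwise ℓ ((∏ i ∈ K, C (y i)) * f) = (#Kᶜ).factorial * ∏ i ∈ Kᶜ, b i := by
  have hterm (I : Finset ι) (q : ℚ) : coeffwise ℓ ((∏ i ∈ K, C (y i)) *
      ((∏ i ∈ I, C (y i)) * (∏ i ∈ I, ratLaurent A (b i)) * algebraMap ℚ A[T;T⁻¹] q)) =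
      (∏ i ∈ I, b i) * C q * C (ℓ ((∏ i ∈ K, y i) * ∏ i ∈ I, y i)) := by
    rw [algebraMap_laurent, ← coeffwise_C, ← coeffwise_ratLaurent_mul]
    congr 1
    simp only [map_mul, map_prod]
    ring
  rw [hf, mul_sum, map_sum]
  simp_rw [hterm]
  rw [sum_eq_single Kᶜ]
  · have h1 : ∑ i ∈ Kᶜ, e i + k = #Kᶜ := by
      rw [sum_sub_distrib] at hk
      simp only [sum_const, nsmul_eq_mul, mul_one] at hk
      linarith
    rw [h1, prod_mul_prod_compl, hℓ, if_pos rfl, sub_self, zpow_zero, mul_one, map_one, mul_one,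
      Int.cast_natCast, prod_range_natCast_sub, map_natCast, mul_comm]
  · intro I _ hI
    have h0 : ℓ ((∏ i ∈ K, y i) * ∏ i ∈ I, y i) = 0 := by
      by_cases hd : Disjoint K I
      · rw [← prod_union hd, hℓ, if_neg]
        intro hu
        exact hI ((IsCompl.of_eq (disjoint_iff.1 hd) hu).compl_eq.symm)
      · obtain ⟨j, hjK, hjI⟩ := not_disjoint_iff.1 hd
        rw [← mul_prod_erase K _ hjK, ← mul_prod_erase I _ hjI,
          show ∀ s t u v : A, s * t * (u * v) = s * u * (t * v) by intros; ring, hy, zero_mul,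
          map_zero]
    rw [h0, map_zero, mul_zero]
  · simp

end Coeffwise

section DerivativeExpansion

/-- Differentiating along the solution of `π = 2 + ∑ y i * β i * π ^ (2 * a i - 1)`. -/
lemma derivation_power_solution_expansion {S B ι : Type*} [CommRing S] [CommRing B] [Algebra S B]
    [Fintype ι] (D : Derivation S B B) (y β s : ι → B) (a : ι → ℕ) (N : ℕ) (x : B)
    (hDy : ∀ i, D (y i) = 0) (hDx : D x = 1) (π : Bˣ) (w : B)
    (hπ : (π : B) = 2 + ∑ i, y i * β i * (π ^ (2 * (a i : ℤ) - 1) : Bˣ))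
    (hw : w = 1 + ∑ i, y i * β i * ((2 * (a i : ℤ) - 1 : ℤ) : B) *
      (π ^ (2 * (a i : ℤ) - 1 - 1) : Bˣ) * w) :
    ((π ^ (-2 * (N : ℤ) - 2) : Bˣ) : B) * D ((π ^ (2 : ℤ) : Bˣ) * (x ^ 2 - 1) +
        4 * ∑ i, y i * (π ^ (2 * (a i : ℤ)) : Bˣ) * s i) =
      2 * (x ^ 2 - 1) * ∑ j, D (β j) * (y j * ((π ^ (2 * (a j : ℤ) - 2 - 2 * N) : Bˣ) * w)) +
      2 * x * ((π ^ (-2 * (N : ℤ)) : Bˣ) * w -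
        ∑ j, β j * (2 * a j - 1) * (y j * ((π ^ (2 * (a j : ℤ) - 2 - 2 * N) : Bˣ) * w))) +
      4 * ∑ i, (D (s i) * (y i * ((π ^ (2 * (a i : ℤ) - 2 - 2 * N) : Bˣ) * w)) -
        ∑ j, D (s i) * β j * (2 * a j - 1) *
          (y i * y j * ((π ^ (2 * (a i : ℤ) + 2 * a j - 4 - 2 * N) : Bˣ) * w))) +
      8 * ∑ i, ∑ j, a i * s i * D (β j) *
        (y i * y j * ((π ^ (2 * (a i : ℤ) + 2 * a j - 4 - 2 * N) : Bˣ) * w)) := by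
  set P : ℤ → B := fun k => ((π ^ k : Bˣ) : B) with hP
  have hPval (k : ℤ) : ((π ^ k : Bˣ) : B) = P k := rfl
  have hadd (j k l : ℤ) (h : j + k = l) : P j * P k = P l := by
    rw [hP]; simp only; rw [← Units.val_mul, ← zpow_add, h]
  have hDP (k : ℤ) : D (P k) = k * P (k - 1) * D π := derivation_unit_zpow D π k
  have hD4 : D (4 : B) = 0 := D.map_natCast 4
  have hDπ : D (π : B) = ∑ j, D (β j) * (y j * (P (2 * (a j : ℤ) - 1) * w)) := by
    have h := congrArg D hπ
    rw [map_add, show D (2 : B) = 0 from D.map_natCast 2, zero_add, map_sum] at h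
    have h' : D (π : B) = ∑ i, D (β i) * (y i * P (2 * (a i : ℤ) - 1)) +
        (∑ i, y i * β i * ((2 * (a i : ℤ) - 1 : ℤ) : B) * P (2 * (a i : ℤ) - 1 - 1)) *
          D (π : B) := by
      conv_lhs => rw [h]
      rw [sum_mul, ← sum_add_distrib]
      refine sum_congr rfl fun i _ => ?_
      rw [D.leibniz, D.leibniz, hDy, hPval, hDP]
      simp only [smul_eq_mul]
      ring
    rw [← sum_mul] at hw
    have h2 : ∑ j, D (β j) * (y j * (P (2 * (a j : ℤ) - 1) * w)) =
        (∑ i, D (β i) * (y i * P (2 * (a i : ℤ) - 1))) * w := by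
      rw [sum_mul]; exact sum_congr rfl fun i _ => by ring
    rw [h2]
    linear_combination w * h' - D (π : B) * hw
  have hPk (k : ℤ) : P k = P k * w -
      ∑ j, β j * (2 * a j - 1) * (y j * (P (k + (2 * (a j : ℤ) - 2)) * w)) := by
    have h : ∑ j, β j * (2 * a j - 1) * (y j * (P (k + (2 * (a j : ℤ) - 2)) * w)) =
        P k * ∑ i, y i * β i * ((2 * (a i : ℤ) - 1 : ℤ) : B) * P (2 * (a i : ℤ) - 1 - 1) * w := by
      rw [mul_sum]
      refine sum_congr rfl fun j _ => ?_
      rw [← hadd k (2 * (a j : ℤ) - 2) _ rfl,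
        show 2 * (a j : ℤ) - 1 - 1 = 2 * (a j : ℤ) - 2 by ring]
      push_cast
      ring
    rw [h]
    linear_combination -P k * hw
  have hDx2 : D (x ^ 2 - 1) = 2 * x := by
    rw [map_sub, D.leibniz_pow, hDx, D.map_one_eq_zero]; simp
  have hlhs : P (-2 * (N : ℤ) - 2) *
      D (P 2 * (x ^ 2 - 1) + 4 * ∑ i, y i * P (2 * (a i : ℤ)) * s i) =
      2 * (x ^ 2 - 1) * (P (-2 * (N : ℤ) - 1) * D (π : B)) + 2 * x * P (-2 * (N : ℤ)) +
      4 * ∑ i, D (s i) * (y i * P (2 * (a i : ℤ) - 2 - 2 * N)) +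
      8 * ∑ i, a i * s i * y i * (P (2 * (a i : ℤ) - 3 - 2 * N) * D (π : B)) := by
    have hs : D (∑ i, y i * P (2 * (a i : ℤ)) * s i) =
        ∑ i, (y i * P (2 * (a i : ℤ)) * D (s i) +
          2 * a i * s i * y i * P (2 * (a i : ℤ) - 1) * D (π : B)) := by
      rw [map_sum]
      refine sum_congr rfl fun i _ => ?_
      rw [D.leibniz, D.leibniz, hDy, hDP]
      simp only [smul_eq_mul]
      push_cast
      ring
    rw [map_add, D.leibniz, D.leibniz, hDx2, hD4, hDP, hs, sum_add_distrib]
    simp only [smul_eq_mul]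
    have e1 := hadd (-2 * (N : ℤ) - 2) 1 (-2 * (N : ℤ) - 1) (by ring)
    have e2 := hadd (-2 * (N : ℤ) - 2) 2 (-2 * (N : ℤ)) (by ring)
    have e3 : ∑ i, D (s i) * (y i * P (2 * (a i : ℤ) - 2 - 2 * N)) =
        P (-2 * (N : ℤ) - 2) * ∑ i, y i * P (2 * (a i : ℤ)) * D (s i) := by
      rw [mul_sum]
      refine sum_congr rfl fun i _ => ?_
      rw [← hadd (-2 * (N : ℤ) - 2) (2 * (a i : ℤ)) _ (by ring)]
      ring
    have e4 : 2 * ∑ i, a i * s i * y i * (P (2 * (a i : ℤ) - 3 - 2 * N) * D (π : B)) =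
        P (-2 * (N : ℤ) - 2) *
          ∑ i, 2 * a i * s i * y i * P (2 * (a i : ℤ) - 1) * D (π : B) := by
      rw [mul_sum, mul_sum]
      refine sum_congr rfl fun i _ => ?_
      rw [← hadd (-2 * (N : ℤ) - 2) (2 * (a i : ℤ) - 1) _ (by ring)]
      ring
    rw [show (2 - 1 : ℤ) = 1 by norm_num]
    push_cast
    linear_combination (2 * (x ^ 2 - 1) * D (π : B)) * e1 + 2 * x * e2 - 4 * e3 - 4 * e4
  simp only [hPval]
  rw [hlhs]
  congr 1
  · congr 1
    · congr 1
      · rw [hDπ, mul_sum]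
        congr 1
        refine sum_congr rfl fun j _ => ?_
        linear_combination (D (β j) * y j * w) *
          hadd (-2 * (N : ℤ) - 1) (2 * (a j : ℤ) - 1) (2 * (a j : ℤ) - 2 - 2 * N) (by ring)
      · nth_rewrite 1 [hPk]
        congr 2
        refine sum_congr rfl fun j _ => ?_
        congr 4
        ring
    · congr 1
      refine sum_congr rfl fun i _ => ?_
      nth_rewrite 1 [hPk]
      rw [mul_sub, mul_sub, mul_sum, mul_sum]
      congr 1
      refine sum_congr rfl fun j _ => ?_
      rw [show 2 * (a i : ℤ) - 2 - 2 * N + (2 * a j - 2) = 2 * (a i : ℤ) + 2 * a j - 4 - 2 * N by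
        ring]
      ring
  · congr 1
    refine sum_congr rfl fun i _ => ?_
    rw [hDπ, mul_sum, mul_sum]
    refine sum_congr rfl fun j _ => ?_
    linear_combination (a i * s i * y i * D (β j) * y j * w) *
      hadd (2 * (a i : ℤ) - 3 - 2 * N) (2 * (a j : ℤ) - 1) (2 * (a i : ℤ) + 2 * a j - 4 - 2 * N)
        (by ring)

end DerivativeExpansion

section ResidueVanishing

open LaurentPolynomial

theorem residue_power_solution_eq_zero {A ι : Type*} [CommRing A] [Algebra ℚ A] [Fintype ι]
    [DecidableEq ι] (ℓ : A →ₗ[ℚ] ℚ) {y : ι → A} (hy : ∀ i, y i * y i = 0)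
    (hℓ : ∀ I : Finset ι, ℓ (∏ i ∈ I, y i) = if I = univ then 1 else 0) (a : ι → ℕ) (N : ℕ)
    (ha : ∑ i, a i = N + Fintype.card ι) (hn : 2 ≤ Fintype.card ι) (π : A[T;T⁻¹]ˣ) (w : A[T;T⁻¹])
    (hπ : (π : A[T;T⁻¹]) =
      2 + ∑ i, C (y i) * ratLaurent A (diffFactor (a i)) * (π ^ (2 * (a i : ℤ) - 1) : A[T;T⁻¹]ˣ))
    (hw : w = 1 + ∑ i, C (y i) * ratLaurent A (diffFactor (a i)) *
      ((2 * (a i : ℤ) - 1 : ℤ) : A[T;T⁻¹]) * (π ^ (2 * (a i : ℤ) - 1 - 1) : A[T;T⁻¹]ˣ) * w)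
    (hπw : ∀ k : ℤ, (π ^ k : A[T;T⁻¹]ˣ) * w = ∑ I : Finset ι, (∏ i ∈ I, C (y i)) *
        (∏ i ∈ I, ratLaurent A (diffFactor (a i))) *
        algebraMap ℚ A[T;T⁻¹]
          ((∏ j ∈ range #I, (((∑ i ∈ I, (2 * (a i : ℤ) - 1) + k : ℤ) : ℚ) - j)) *
          2 ^ (∑ i ∈ I, (2 * (a i : ℤ) - 1) + k - #I))) :
    ℓ (((T (-(N + 1)) : A[T;T⁻¹]) * (((π ^ (-2 * (N : ℤ) - 2) : A[T;T⁻¹]ˣ) : A[T;T⁻¹]) *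
      laurentDeriv A (((π ^ (2 : ℤ) : A[T;T⁻¹]ˣ) : A[T;T⁻¹]) * ((T 1 : A[T;T⁻¹]) ^ 2 - 1) +
        4 * ∑ i, C (y i) * (π ^ (2 * (a i : ℤ)) : A[T;T⁻¹]ˣ) *
          ratLaurent A (sumFactor (a i))))).coeff (-1)) = 0 := by
  have hexp := derivation_power_solution_expansion (laurentDeriv A) (fun i => C (y i))
    (fun i => ratLaurent A (diffFactor (a i))) (fun i => ratLaurent A (sumFactor (a i))) a N (T 1)
    (fun i => laurentDeriv_C _) (by simp [laurentDeriv_T]) π w hπ hw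
  simp only [laurentDeriv_ratLaurent] at hexp
  rw [← coeff_coeffwise, hexp, ← ratLaurent_T, coeffwise_ratLaurent_mul]
  set M : ℤ → A[T;T⁻¹] := fun k => (π ^ k : A[T;T⁻¹]ˣ) * w with hM
  have hMval (k : ℤ) : (π ^ k : A[T;T⁻¹]ˣ) * w = M k := rfl
  set β' : ι → ℚ[T;T⁻¹] := fun i => ∏ j ∈ univ.erase i, diffFactor (a j) with hβ'
  obtain ⟨m, hm⟩ : ∃ m, Fintype.card ι = m + 2 := ⟨Fintype.card ι - 2, by omega⟩
  have hasum : ∑ i, (a i : ℤ) = N + (m + 2) := by rw [← Nat.cast_sum, ha, hm]; push_cast; ring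
  have hsum (K : Finset ι) : ∑ i ∈ Kᶜ, (2 * (a i : ℤ) - 1 - 1) =
      2 * N - ∑ i ∈ K, (2 * (a i : ℤ) - 2) := by
    have h1 := sum_add_sum_compl K fun i => 2 * (a i : ℤ) - 2
    have h2 : ∑ i, (2 * (a i : ℤ) - 2) = 2 * N := by
      rw [sum_sub_distrib, ← mul_sum, hasum]; simp [hm]; ring
    have h3 : ∑ i ∈ Kᶜ, (2 * (a i : ℤ) - 1 - 1) = ∑ i ∈ Kᶜ, (2 * (a i : ℤ) - 2) :=
      sum_congr rfl fun i _ => by ring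
    linarith
  have hL (K : Finset ι) (k : ℤ) (hk : k = ∑ i ∈ K, (2 * (a i : ℤ) - 2) - 2 * N) :
      coeffwise ℓ ((∏ i ∈ K, C (y i)) * M k) =
        (#Kᶜ).factorial * ∏ i ∈ Kᶜ, diffFactor (a i) :=
    coeffwise_prod_mul ℓ hy hℓ _ _ K (hπw k) (by rw [hsum, hk]; ring)
  have hL0 (g : ℚ[T;T⁻¹]) : coeffwise ℓ (ratLaurent A g * M (-2 * N)) =
      g * (((m + 2) * (m + 1) * m.factorial : ℕ) * ∏ i, diffFactor (a i)) := by
    have h := hL ∅ (-2 * N) (by simp)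
    rw [prod_empty, one_mul, compl_empty, card_univ, hm, Nat.factorial_succ, Nat.factorial_succ,
      ← mul_assoc] at h
    rw [coeffwise_ratLaurent_mul, h]
  have hL1 (g : ℚ[T;T⁻¹]) (i : ι) :
      coeffwise ℓ (ratLaurent A g * (C (y i) * M (2 * a i - 2 - 2 * N))) =
      g * (((m + 1) * m.factorial : ℕ) * β' i) := by
    have h := hL {i} (2 * a i - 2 - 2 * N) (by simp)
    rw [prod_singleton, compl_eq_univ_sdiff, sdiff_singleton_eq_erase,
      card_erase_of_mem (mem_univ i),
      card_univ, hm, show m + 2 - 1 = m + 1 by omega, Nat.factorial_succ] at h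
    rw [coeffwise_ratLaurent_mul, h]
  have hL2 (g : ℚ[T;T⁻¹]) (i j : ι) (hij : i ≠ j) :
      coeffwise ℓ (ratLaurent A g * (C (y i) * C (y j) * M (2 * a i + 2 * a j - 4 - 2 * N))) =
      g * ((m.factorial : ℕ) * ∏ k ∈ (univ.erase i).erase j, diffFactor (a k)) := by
    have h := hL {i, j} (2 * a i + 2 * a j - 4 - 2 * N) (by rw [sum_pair hij]; ring)
    have hc : ({i, j} : Finset ι)ᶜ = (univ.erase i).erase j := by ext k; simp; tauto
    rw [prod_pair hij, hc, card_erase_of_mem (by simp [hij.symm]), card_erase_of_mem (mem_univ i),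
      card_univ, hm, show m + 2 - 1 - 1 = m by omega] at h
    rw [coeffwise_ratLaurent_mul, h]
  have hL2' (g : ι → ℚ[T;T⁻¹]) (i : ι) :
      coeffwise ℓ (∑ j, ratLaurent A (g j) *
        (C (y i) * C (y j) * M (2 * a i + 2 * a j - 4 - 2 * N))) =
      m.factorial * ∑ j ∈ univ.erase i, (∏ k ∈ (univ.erase i).erase j, diffFactor (a k)) * g j := by
    rw [map_sum, ← add_sum_erase univ _ (mem_univ i), ← map_mul C, hy]
    simp only [map_zero, zero_mul, mul_zero, zero_add, mul_sum]
    refine sum_congr rfl fun j hj => ?_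
    rw [hL2 _ i j (ne_of_mem_erase hj).symm]
    ring
  have hres := coeff_neg_one_factor_expansion a N ha
  have hcast (k : ℕ) : 2 * (k : A[T;T⁻¹]) - 1 = ratLaurent A (2 * (k : ℚ[T;T⁻¹]) - 1) := by
    rw [map_sub, map_mul, map_ofNat, map_one, map_natCast]
  have hasum' : ∑ i, (2 * (a i : ℚ[T;T⁻¹]) - 1) = 2 * N + m + 2 := by
    rw [sum_sub_distrib, ← mul_sum, ← Nat.cast_sum, ha, hm, sum_const, card_univ, hm]
    push_cast
    rw [nsmul_eq_mul]
    push_cast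
    ring
  have e1 : coeffwise ℓ (2 * ((T 1 : A[T;T⁻¹]) ^ 2 - 1) * ∑ j,
      ratLaurent A (laurentDeriv ℚ (diffFactor (a j))) *
        (C (y j) * M (2 * a j - 2 - 2 * N))) =
      2 * ((T 1 : ℚ[T;T⁻¹]) ^ 2 - 1) * (((m + 1) * m.factorial : ℕ) *
        laurentDeriv ℚ (∏ i, diffFactor (a i))) := by
    rw [show (2 * ((T 1 : A[T;T⁻¹]) ^ 2 - 1)) = ratLaurent A (2 * ((T 1 : ℚ[T;T⁻¹]) ^ 2 - 1)) by
      rw [map_mul, map_sub, map_pow, map_one, ratLaurent_T, map_ofNat], coeffwise_ratLaurent_mul,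
      map_sum, derivation_prod, mul_sum (a := (((m + 1) * m.factorial : ℕ) : ℚ[T;T⁻¹]))]
    congr 1
    exact sum_congr rfl fun j _ => by rw [hL1]; ring
  have e2 : coeffwise ℓ (2 * (T 1 : A[T;T⁻¹]) * (M (-2 * N) - ∑ j,
      ratLaurent A (diffFactor (a j)) * (2 * (a j : A[T;T⁻¹]) - 1) *
        (C (y j) * M (2 * a j - 2 - 2 * N)))) =
      -(2 * ((T 1 : ℚ[T;T⁻¹])) * (2 * N * ((m + 1) * m.factorial : ℕ) *
        ∏ i, diffFactor (a i))) := by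
    rw [show (2 * (T 1 : A[T;T⁻¹])) = ratLaurent A (2 * (T 1 : ℚ[T;T⁻¹])) by
      rw [map_mul, ratLaurent_T, map_ofNat], coeffwise_ratLaurent_mul, map_sub, map_sum,
      ← one_mul (M (-2 * N)), ← map_one (ratLaurent A), hL0]
    have h (j : ι) : coeffwise ℓ (ratLaurent A (diffFactor (a j)) * (2 * (a j : A[T;T⁻¹]) - 1) *
        (C (y j) * M (2 * a j - 2 - 2 * N))) = (2 * (a j : ℚ[T;T⁻¹]) - 1) *
          (((m + 1) * m.factorial : ℕ) * ∏ i, diffFactor (a i)) := by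
      rw [hcast, ← map_mul (ratLaurent A), hL1, ← prod_erase_mul univ _ (mem_univ j)]
      ring
    simp_rw [map_one, h]
    rw [← sum_mul, hasum']
    push_cast
    ring
  have e3 : coeffwise ℓ (4 * ∑ i, (ratLaurent A (laurentDeriv ℚ (sumFactor (a i))) *
        (C (y i) * M (2 * a i - 2 - 2 * N)) -
      ∑ j, ratLaurent A (laurentDeriv ℚ (sumFactor (a i))) * ratLaurent A (diffFactor (a j)) *
        (2 * (a j : A[T;T⁻¹]) - 1) *
        (C (y i) * C (y j) * M (2 * a i + 2 * a j - 4 - 2 * N)))) =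
      4 * ∑ i, (2 * (m.factorial : ℚ[T;T⁻¹])) * ((((a i : ℕ) : ℚ[T;T⁻¹]) - N - 1) *
        laurentDeriv ℚ (sumFactor (a i)) * β' i) := by
    rw [← map_ofNat (ratLaurent A) 4, coeffwise_ratLaurent_mul, map_sum]
    congr 1
    refine sum_congr rfl fun i _ => ?_
    simp_rw [hcast, ← map_mul (ratLaurent A)]
    rw [map_sub (coeffwise ℓ), hL1, hL2']
    have h : ∑ j ∈ univ.erase i, (∏ k ∈ (univ.erase i).erase j, diffFactor (a k)) *
        (laurentDeriv ℚ (sumFactor (a i)) * diffFactor (a j) * (2 * (a j : ℚ[T;T⁻¹]) - 1)) =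
        (2 * N + m + 2 - (2 * (a i : ℚ[T;T⁻¹]) - 1)) *
          (laurentDeriv ℚ (sumFactor (a i)) * β' i) := by
      rw [← hasum', ← add_sum_erase univ _ (mem_univ i), add_sub_cancel_left, sum_mul]
      refine sum_congr rfl fun j hj => ?_
      rw [show β' i = ∏ j ∈ univ.erase i, diffFactor (a j) from rfl, ← prod_erase_mul _ _ hj]
      ring
    rw [h]
    push_cast
    ring
  have e4 : coeffwise ℓ (8 * ∑ i, ∑ j, (a i : A[T;T⁻¹]) * ratLaurent A (sumFactor (a i)) *
        ratLaurent A (laurentDeriv ℚ (diffFactor (a j))) *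
        (C (y i) * C (y j) * M (2 * a i + 2 * a j - 4 - 2 * N))) =
      4 * ∑ i, (2 * (m.factorial : ℚ[T;T⁻¹])) * (((a i : ℕ) : ℚ[T;T⁻¹]) * sumFactor (a i) *
        laurentDeriv ℚ (β' i)) := by
    rw [← map_ofNat (ratLaurent A) 8, coeffwise_ratLaurent_mul, map_sum, mul_sum, mul_sum]
    refine sum_congr rfl fun i _ => ?_
    simp_rw [← map_natCast (ratLaurent A), ← map_mul (ratLaurent A)]
    rw [hL2', hβ', derivation_prod]
    simp_rw [mul_sum]
    refine sum_congr rfl fun j _ => ?_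
    ring
  simp only [hMval]
  rw [map_add, map_add, map_add, e1, e2, e3, e4]
  have hfin : ∀ u v : ℚ[T;T⁻¹], u.coeff (-1) = 0 →
      v = C ((2 * m.factorial : ℕ) : ℚ) * u → v.coeff (-1) = 0 := by
    rintro u v h rfl
    rw [coeff_C_mul, h, mul_zero]
  refine hfin _ _ hres ?_
  rw [sum_add_distrib, hm, map_natCast]
  simp only [← mul_sum]
  push_cast
  ring

end ResidueVanishing

section Branches

variable {S R ι : Type*} [CommRing S] [CommRing R] [Algebra S R]

lemma isNilpotent_lagrangeSubst_sub (D : Derivation S R R) (y : ι → S) (φ : ι → R)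
    (hy : ∀ i, y i * y i = 0) (J : Finset ι) (G : R) :
    IsNilpotent (lagrangeSubst D y φ J G - G) := by
  rw [lagrangeSubst, add_sub_cancel_left]
  refine isNilpotent_sum fun I hI => ⟨2, ?_⟩
  obtain ⟨i, hi⟩ := (mem_filter.1 hI).2
  rw [smul_pow, pow_two, ← prod_mul_distrib, prod_eq_zero hi (hy i), zero_smul]

variable [DecidableEq ι]

lemma lagrangeSubst_add (D : Derivation S R R) (y : ι → S) (φ : ι → R) (J : Finset ι) (G H : R) :
    lagrangeSubst D y φ J (G + H) = lagrangeSubst D y φ J G + lagrangeSubst D y φ J H := by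
  induction J using Finset.induction_on with
  | empty => simp [lagrangeSubst_empty]
  | insert j J hj ih =>
    rw [lagrangeSubst_insert D y φ hj, lagrangeSubst_insert D y φ hj,
      lagrangeSubst_insert D y φ hj, ih, map_add, mul_add, lagrangeDensity_add, smul_add]
    ring

lemma lagrangeSubst_of_derivation_eq_zero (D : Derivation S R R) (y : ι → S) (φ : ι → R)
    (J : Finset ι) {G : R} (hG : D G = 0) : lagrangeSubst D y φ J G = G := by
  have h (k : ℕ) : D^[k] (0 : R) = 0 := by
    induction k with
    | zero => rfl
    | succ k ih => rw [Function.iterate_succ_apply, map_zero, ih]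
  simp [lagrangeSubst, hG, h]

/-- Lagrange expansion is a ring homomorphism when the parameters square to zero. -/
def lagrangeHom (D : Derivation S R R) (y : ι → S) (φ : ι → R) (hy : ∀ i, y i * y i = 0)
    (J : Finset ι) : R →+* R where
  toFun := lagrangeSubst D y φ J
  map_one' := lagrangeSubst_of_derivation_eq_zero D y φ J D.map_one_eq_zero
  map_mul' := lagrangeSubst_mul D y φ hy J
  map_zero' := lagrangeSubst_of_derivation_eq_zero D y φ J (map_zero D)
  map_add' := lagrangeSubst_add D y φ J

open LaurentPolynomial

variable {A : Type*} [CommRing A] [Algebra ℚ A]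

/-- The derivation `T⁻¹ d/dT`, which is differentiation with respect to `T² / 2`. -/
noncomputable def halfSquareDeriv (A : Type*) [CommRing A] : Derivation A A[T;T⁻¹] A[T;T⁻¹] :=
  (T (-1) : A[T;T⁻¹]) • laurentDeriv A

lemma halfSquareDeriv_C_mul_T (c : A) (k : ℤ) :
    halfSquareDeriv A (C c * T k) = C (c * k) * T (k - 2) := by
  rw [halfSquareDeriv, Derivation.smul_apply, laurentDeriv_C_mul_T, smul_eq_mul, map_mul,
    map_intCast, show k - 2 = -1 + (k - 1) by ring, T_add]
  ring

lemma iterate_halfSquareDeriv (c : A) (m : ℕ) (k : ℤ) :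
    (halfSquareDeriv A)^[m] (C c * T k) =
      C (c * ∏ i ∈ Icc 1 m, (k + 2 - 2 * (i : A))) * T (k - 2 * m) := by
  induction m with
  | zero => simp
  | succ m ih =>
    rw [Function.iterate_succ_apply', ih, halfSquareDeriv_C_mul_T, prod_Icc_succ_top (by omega)]
    push_cast
    congr 2
    · ring
    · ring

/-- The solution near `1 + ε T` of `(z - 1)² = T² + 2 ∑ i, y i * z ^ (2 * a i)`. -/
noncomputable def branch [Fintype ι] (y : ι → A) (a : ι → ℕ) (ε : A) : A[T;T⁻¹] :=
  lagrangeSubst (halfSquareDeriv A) y (fun i => (1 + C ε * T 1) ^ (2 * a i)) univ (1 + C ε * T 1)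

lemma isNilpotent_branch_sub [Fintype ι] (y : ι → A) (hy : ∀ i, y i * y i = 0) (a : ι → ℕ) (ε : A) :
    IsNilpotent (branch y a ε - (1 + C ε * T 1)) :=
  isNilpotent_lagrangeSubst_sub _ _ _ hy _ _

lemma branch_sub_one_sq [Fintype ι] (y : ι → A) (hy : ∀ i, y i * y i = 0) (a : ι → ℕ) {ε : A}
    (hε : ε * ε = 1) :
    (branch y a ε - 1) ^ 2 =
      (T 1 : A[T;T⁻¹]) ^ 2 + 2 * ∑ i, C (y i) * branch y a ε ^ (2 * a i) := by
  set L := lagrangeHom (halfSquareDeriv A) y (fun i => (1 + C ε * T 1) ^ (2 * a i)) hy univ with hL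
  have hb : branch y a ε = L (1 + C ε * T 1) := rfl
  have h2 : (2 : A[T;T⁻¹]) * C (algebraMap ℚ A (1 / 2)) = 1 := by
    rw [← map_ofNat (C : A →+* A[T;T⁻¹]) 2, ← map_mul, ← map_ofNat (algebraMap ℚ A) 2, ← map_mul]
    norm_num
  have hs : halfSquareDeriv A (C (algebraMap ℚ A (1 / 2)) * T 2) = 1 := by
    rw [halfSquareDeriv_C_mul_T]
    push_cast
    rw [map_mul, map_ofNat, mul_comm (C _) (2 : A[T;T⁻¹]), h2]
    simp
  have hsub := lagrangeSubst_of_derivation_eq_one (halfSquareDeriv A) y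
    (fun i => (1 + C ε * T 1) ^ (2 * a i)) hy univ hs
  change L _ = _ + ∑ i, y i • L _ at hsub
  have hT : (2 : A[T;T⁻¹]) * (C (algebraMap ℚ A (1 / 2)) * T 2) = (C ε * T 1) ^ 2 := by
    rw [← mul_assoc, h2, one_mul, mul_pow, ← map_pow, pow_two ε, hε, map_one, one_mul, T_pow]
    rfl
  have hT' : (C ε * T 1 : A[T;T⁻¹]) ^ 2 = T 1 ^ 2 := by
    rw [mul_pow, ← map_pow, pow_two ε, hε, map_one, one_mul]
  have h3 : (branch y a ε - 1) ^ 2 = L ((C ε * T 1) ^ 2) := by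
    rw [hb, map_add, map_one, map_pow]; ring
  rw [h3, ← hT, map_mul, map_ofNat, hsub, mul_add, hT, hT']
  simp_rw [map_pow, ← hb, smul_eq_C_mul]

lemma branch_sq [Fintype ι] (y : ι → A) (hy : ∀ i, y i * y i = 0) (a : ι → ℕ) (ε : A) :
    branch y a ε ^ 2 = (1 + C ε * T 1) ^ 2 + 2 * ∑ I : Finset ι with I.Nonempty,
      C (∏ i ∈ I, y i) * (halfSquareDeriv A)^[#I - 1]
        (C ε * T (-1) * (1 + C ε * T 1) ^ (2 * ∑ i ∈ I, a i + 1)) := by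
  have h : branch y a ε ^ 2 = lagrangeSubst (halfSquareDeriv A) y
      (fun i => (1 + C ε * T 1) ^ (2 * a i)) univ ((1 + C ε * T 1) ^ 2) :=
    (map_pow (lagrangeHom (halfSquareDeriv A) y (fun i => (1 + C ε * T 1) ^ (2 * a i)) hy univ)
      _ 2).symm
  have hD : halfSquareDeriv A ((1 + C ε * T 1) ^ 2) =
      (2 : A) • (C ε * T (-1) * (1 + C ε * T 1)) := by
    rw [Derivation.leibniz_pow, map_add, Derivation.map_one_eq_zero, halfSquareDeriv_C_mul_T,
      smul_eq_C_mul, map_ofNat]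
    simp
    ring
  rw [h, lagrangeSubst, hD, mul_sum, powerset_univ]
  congr 1
  refine sum_congr rfl fun I _ => ?_
  rw [mul_smul_comm, iterate_derivation_smul, smul_eq_C_mul, smul_eq_C_mul, map_ofNat,
    prod_pow_eq_pow_sum, ← mul_sum, pow_succ]
  rw [show (1 + C ε * T 1 : A[T;T⁻¹]) ^ (2 * ∑ i ∈ I, a i) * (C ε * T (-1) * (1 + C ε * T 1)) =
    C ε * T (-1) * ((1 + C ε * T 1) ^ (2 * ∑ i ∈ I, a i) * (1 + C ε * T 1)) by ring]
  ring

end Branches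

section Transfer

open LaurentPolynomial

lemma units_sub_dvd_zpow_sub_zpow {R : Type*} [CommRing R] (p q : Rˣ) (k : ℤ) :
    (p - q : R) ∣ ((p ^ k : Rˣ) - (q ^ k : Rˣ) : R) := by
  obtain ⟨k, rfl | rfl⟩ := k.eq_nat_or_neg
  · simpa using sub_dvd_pow_sub_pow (p : R) q k
  · obtain ⟨c, hc⟩ := sub_dvd_pow_sub_pow (p : R) q k
    refine ⟨-c * ((p ^ k)⁻¹ : Rˣ) * ((q ^ k)⁻¹ : Rˣ), ?_⟩
    have hp : ((p ^ k : Rˣ) : R) * ((p ^ k)⁻¹ : Rˣ) = 1 := Units.mul_inv _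
    have hq : ((q ^ k : Rˣ) : R) * ((q ^ k)⁻¹ : Rˣ) = 1 := Units.mul_inv _
    rw [Units.val_pow_eq_pow_val] at hp hq
    rw [zpow_neg, zpow_neg, zpow_natCast, zpow_natCast]
    linear_combination -(((p ^ k)⁻¹ : Rˣ) : R) * ((q ^ k)⁻¹ : Rˣ) * hc -
      (((p ^ k)⁻¹ : Rˣ) : R) * hq + (((q ^ k)⁻¹ : Rˣ) : R) * hp

lemma power_solution_unique {R ι : Type*} [CommRing R] [Fintype ι] {y : ι → R}
    (hy : ∀ i, y i * y i = 0) (β : ι → R) (e : ι → ℤ) {p q : Rˣ} (c : R)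
    (hp : (p : R) = c + ∑ i, y i * β i * (p ^ e i : Rˣ))
    (hq : (q : R) = c + ∑ i, y i * β i * (q ^ e i : Rˣ)) : p = q := by
  choose d hd using fun i => units_sub_dvd_zpow_sub_zpow p q (e i)
  have hnil : IsNilpotent (∑ i, y i * β i * d i) :=
    isNilpotent_sum fun i _ => ⟨2, by linear_combination (β i * d i) ^ 2 * hy i⟩
  have h : (p - q : R) * (1 - ∑ i, y i * β i * d i) = 0 := by
    have h1 : (p - q : R) = ∑ i, y i * β i * ((p ^ e i : Rˣ) - (q ^ e i : Rˣ) : R) := by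
      simp_rw [mul_sub, sum_sub_distrib]
      linear_combination hp - hq
    rw [mul_sub, mul_one, mul_sum]
    nth_rw 1 [h1]
    rw [sub_eq_zero]
    exact sum_congr rfl fun i _ => by rw [hd]; ring
  exact Units.ext (sub_eq_zero.1 ((hnil.isUnit_one_sub.mul_left_eq_zero).1 h))

lemma isUnit_add_of_isNilpotent {R : Type*} [CommRing R] {u x : R} (hu : IsUnit u)
    (hx : IsNilpotent (x - u)) : IsUnit x := by
  have := IsNilpotent.isUnit_add_left_of_commute hx hu (Commute.all _ _)
  rwa [add_sub_cancel] at this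

variable {A ι : Type*} [CommRing A] [Algebra ℚ A] [Fintype ι] [DecidableEq ι]

theorem residue_branch_eq_zero (ℓ : A →ₗ[ℚ] ℚ) {y : ι → A} (hy : ∀ i, y i * y i = 0)
    (hℓ : ∀ I : Finset ι, ℓ (∏ i ∈ I, y i) = if I = univ then 1 else 0) (a : ι → ℕ) (N : ℕ)
    (ha : ∑ i, a i = N + Fintype.card ι) (hn : 2 ≤ Fintype.card ι) {X Y : A[T;T⁻¹]}
    (hX : 4 * X = branch y a 1 ^ 2 - branch y a (-1) ^ 2) (hXY : X ^ (N + 1) * Y = 1) :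
    ℓ ((T 1 * Y : A[T;T⁻¹]).coeff (-1)) = 0 := by
  set V := branch y a 1 with hV
  set W := branch y a (-1) with hW
  have hVn : IsNilpotent (V - (1 + T 1)) := by simpa using isNilpotent_branch_sub y hy a 1
  have hWn : IsNilpotent (W - (1 - T 1)) := by
    simpa [sub_eq_add_neg] using isNilpotent_branch_sub y hy a (-1)
  have hVsq := branch_sub_one_sq y hy a (ε := 1) (by ring)
  have hWsq := branch_sub_one_sq y hy a (ε := -1) (by ring)
  rw [← hV] at hVsq
  rw [← hW] at hWsq
  have hC2 : (C (algebraMap ℚ A (1 / 2)) : A[T;T⁻¹]) * 2 = 1 := by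
    rw [← map_ofNat (C : A →+* A[T;T⁻¹]) 2, ← map_mul, ← map_ofNat (algebraMap ℚ A) 2, ← map_mul]
    norm_num
  have htwo : IsUnit (2 : A[T;T⁻¹]) := IsUnit.of_mul_eq_one_right _ hC2
  have hTu : IsUnit (T 1 : A[T;T⁻¹]) := isUnit_T 1
  have hpn : IsNilpotent (V + W - 2) := by
    convert (Commute.all _ _).isNilpotent_add hVn hWn using 1; ring
  have hqn : IsNilpotent (V - W - 2 * T 1) := by
    convert (Commute.all _ _).isNilpotent_sub hVn hWn using 1; ring
  obtain ⟨p, hp⟩ := isUnit_add_of_isNilpotent htwo hpn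
  obtain ⟨q, hq⟩ := isUnit_add_of_isNilpotent (htwo.mul hTu) hqn
  set τ : A[T;T⁻¹]ˣ := q * p⁻¹ with hτ
  have hpτ : (p : A[T;T⁻¹]) * τ = q := by rw [hτ, Units.val_mul, mul_left_comm, p.mul_inv, mul_one]
  have hTT : (T 1 : A[T;T⁻¹]) * T (-1) = 1 := by rw [← T_add]; simp
  have hν : IsNilpotent ((T (-1) : A[T;T⁻¹]) * (τ : A[T;T⁻¹]) - 1) := by
    have h1 : IsNilpotent ((V - W - 2 * T 1) - T 1 * (V + W - 2)) :=
      (Commute.all _ _).isNilpotent_sub hqn ((Commute.all _ _).isNilpotent_mul_left hpn)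
    have h2 : (T (-1) : A[T;T⁻¹]) * (τ : A[T;T⁻¹]) - 1 =
        ((T (-1) : A[T;T⁻¹]) * ((p⁻¹ : A[T;T⁻¹]ˣ) : A[T;T⁻¹])) *
          ((V - W - 2 * T 1) - T 1 * (V + W - 2)) := by
      have hpp : (p : A[T;T⁻¹]) * (p⁻¹ : A[T;T⁻¹]ˣ) = 1 := p.mul_inv
      rw [hτ, Units.val_mul]
      linear_combination (T (-1) : A[T;T⁻¹]) * ((p⁻¹ : A[T;T⁻¹]ˣ) : A[T;T⁻¹]) * (hq - T 1 * hp) +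
        (T 1 : A[T;T⁻¹]) * T (-1) * hpp + hTT
    rw [h2]
    exact (Commute.all _ _).isNilpotent_mul_left h1
  have hτT : (τ : A[T;T⁻¹]) = T 1 * (1 + ((T (-1) : A[T;T⁻¹]) * (τ : A[T;T⁻¹]) - 1)) := by
    linear_combination -(τ : A[T;T⁻¹]) * hTT
  set Θ : A[T;T⁻¹] →+* A[T;T⁻¹] := eval₂ C τ with hΘ
  have hΘC (b : A) : Θ (C b) = C b := eval₂_C _ _ _
  have hΘT (k : ℤ) : Θ (T k) = (τ ^ k : A[T;T⁻¹]ˣ) := eval₂_T _ _ _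
  have hΘhp : V = p * Θ (ratLaurent A halfPlus) := by
    rw [halfPlus, map_mul, map_add, ratLaurent_C, map_one, ratLaurent_T, map_mul, hΘC, map_add,
      map_one, hΘT, zpow_one]
    linear_combination -C (algebraMap ℚ A (1 / 2)) * (hp + hq + hpτ) - V * hC2
  have hΘhm : W = p * Θ (ratLaurent A halfMinus) := by
    rw [halfMinus, map_mul, map_sub, ratLaurent_C, map_one, ratLaurent_T, map_mul, hΘC, map_sub,
      map_one, hΘT, zpow_one]
    linear_combination -C (algebraMap ℚ A (1 / 2)) * (hp - hq - hpτ) - W * hC2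
  have hdiff (m : ℕ) : (τ : A[T;T⁻¹]) * p ^ (2 * m) * Θ (ratLaurent A (diffFactor m)) =
      2 * (V ^ (2 * m) - W ^ (2 * m)) := by
    have hττ : (τ : A[T;T⁻¹]) * (τ⁻¹ : A[T;T⁻¹]ˣ) = 1 := τ.mul_inv
    rw [diffFactor]
    simp only [map_mul, map_sub, map_pow, map_ofNat, ratLaurent_T]
    rw [hΘT, zpow_neg_one, hΘhp, hΘhm]
    linear_combination 2 * (p : A[T;T⁻¹]) ^ (2 * m) * (Θ (ratLaurent A halfPlus) ^ (2 * m) -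
      Θ (ratLaurent A halfMinus) ^ (2 * m)) * hττ
  have hsum (m : ℕ) : 2 * ((p : A[T;T⁻¹]) ^ (2 * m) * Θ (ratLaurent A (sumFactor m))) =
      p ^ (2 * m) * Θ (ratLaurent A (diffFactor m)) - 2 * (V ^ (2 * m) + W ^ (2 * m)) := by
    rw [diffFactor, sumFactor]
    simp only [map_mul, map_sub, map_add, map_pow, map_ofNat, ratLaurent_T]
    rw [hΘhp, hΘhm]
    ring
  have hp2 : (p : A[T;T⁻¹]) * (p - 2) =
      ∑ i, C (y i) * (p ^ (2 * a i) * Θ (ratLaurent A (diffFactor (a i)))) := by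
    refine τ.isUnit.mul_left_cancel ?_
    rw [mul_sum]
    have h1 : ∑ i, (τ : A[T;T⁻¹]) *
        (C (y i) * (p ^ (2 * a i) * Θ (ratLaurent A (diffFactor (a i))))) =
        2 * ∑ i, C (y i) * V ^ (2 * a i) - 2 * ∑ i, C (y i) * W ^ (2 * a i) := by
      rw [← mul_sub, ← sum_sub_distrib, mul_sum]
      exact sum_congr rfl fun i _ => by linear_combination C (y i) * hdiff (a i)
    rw [h1]
    linear_combination hVsq - hWsq + (p - 2 : A[T;T⁻¹]) * (hpτ + hq) + (V - W) * hp
  obtain ⟨π, w, hπ, hw, hπw⟩ := exists_lagrange_power_solution (fun i => (C (y i) : A[T;T⁻¹]))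
    (fun i => ratLaurent A (diffFactor (a i))) (fun i => 2 * (a i : ℤ) - 1)
    (fun i => by rw [← map_mul, hy, map_zero])
  have hΘπ (k : ℤ) : Θ ((π ^ k : A[T;T⁻¹]ˣ) : A[T;T⁻¹]) =
      ((Units.map Θ.toMonoidHom π) ^ k : A[T;T⁻¹]ˣ) := by
    rw [← map_zpow]; rfl
  have hpπ : p = Units.map Θ.toMonoidHom π := by
    refine power_solution_unique (y := fun i => (C (y i) : A[T;T⁻¹]))
      (fun i => by rw [← map_mul, hy, map_zero])
      (fun i => Θ (ratLaurent A (diffFactor (a i)))) (fun i => 2 * (a i : ℤ) - 1) 2 ?_ ?_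
    · refine p.isUnit.mul_left_cancel ?_
      rw [mul_add, mul_sum]
      have h1 (i : ι) : (p : A[T;T⁻¹]) * (C (y i) * Θ (ratLaurent A (diffFactor (a i))) *
          (p ^ (2 * (a i : ℤ) - 1) : A[T;T⁻¹]ˣ)) =
          C (y i) * (p ^ (2 * a i) * Θ (ratLaurent A (diffFactor (a i)))) := by
        have h2 : (p : A[T;T⁻¹]) * (p ^ (2 * (a i : ℤ) - 1) : A[T;T⁻¹]ˣ) = p ^ (2 * a i) := by
          rw [← Units.val_mul, ← Units.val_pow_eq_pow_val, ← zpow_natCast, ← zpow_one_add]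
          congr 2
          push_cast
          ring
        rw [← h2]
        ring
      simp_rw [h1]
      linear_combination hp2
    · have h := congrArg Θ hπ
      simp only [map_add, map_sum, map_mul, map_ofNat, hΘC, hΘπ] at h
      exact h
  have hres := residue_power_solution_eq_zero ℓ hy hℓ a N ha hn π w hπ hw hπw
  rw [← coeff_neg_one_eval₂_mul_laurentDeriv τ hν hτT, map_mul, map_mul, mul_assoc, mul_assoc,
    ← laurentDeriv_eval₂, ← hΘ, hΘT, hΘπ, ← hpπ] at hres
  have hh : Θ (((π ^ (2 : ℤ) : A[T;T⁻¹]ˣ) : A[T;T⁻¹]) * ((T 1 : A[T;T⁻¹]) ^ 2 - 1) +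
        4 * ∑ i, C (y i) * (π ^ (2 * (a i : ℤ)) : A[T;T⁻¹]ˣ) * ratLaurent A (sumFactor (a i))) =
      C 4 * (T 2 - 1) := by
    simp only [map_add, map_mul, map_sub, map_sum, map_pow, map_ofNat, map_one, hΘC, hΘπ, hΘT,
      ← hpπ]
    have h1 : 4 * ∑ i, C (y i) * (p ^ (2 * (a i : ℤ)) : A[T;T⁻¹]ˣ) *
        Θ (ratLaurent A (sumFactor (a i))) =
        2 * ∑ i, C (y i) * (p ^ (2 * a i) * Θ (ratLaurent A (diffFactor (a i)))) -
        2 * (2 * ∑ i, C (y i) * V ^ (2 * a i)) - 2 * (2 * ∑ i, C (y i) * W ^ (2 * a i)) := by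
      simp only [mul_sum]
      rw [← sum_sub_distrib, ← sum_sub_distrib]
      refine sum_congr rfl fun i _ => ?_
      have h3 : ((p ^ (2 * (a i : ℤ)) : A[T;T⁻¹]ˣ) : A[T;T⁻¹]) = p ^ (2 * a i) := by
        rw [← Units.val_pow_eq_pow_val, ← zpow_natCast]; push_cast; rfl
      rw [h3]
      linear_combination 2 * C (y i) * hsum (a i)
    have h4 : (T 2 : A[T;T⁻¹]) = T 1 ^ 2 := by rw [T_pow]; rfl
    have h5 : ((p ^ (2 : ℤ) : A[T;T⁻¹]ˣ) : A[T;T⁻¹]) = p ^ 2 := by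
      rw [← Units.val_pow_eq_pow_val]; rfl
    rw [h1, ← hp2, h4, h5, zpow_one]
    linear_combination 2 * hVsq + 2 * hWsq + (p * τ + q : A[T;T⁻¹]) * hpτ + (q + V - W) * hq +
      (p + V + W - 4) * hp
  have h8 : laurentDeriv A (C 4 * (T 2 - 1)) = 8 * T 1 := by
    rw [mul_sub, map_sub, laurentDeriv_C_mul_T, mul_one, laurentDeriv_C, sub_zero, map_ofNat]
    push_cast
    ring
  have hXp : 4 * X = p ^ 2 * τ := by
    linear_combination hX - (V - W) * hp - p * hpτ - p * hq
  rw [hh, h8] at hres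
  have hval : (4 : A[T;T⁻¹]) ^ (N + 1) * (((τ ^ (-((N : ℤ) + 1)) : A[T;T⁻¹]ˣ) : A[T;T⁻¹]) *
      (((p ^ (-2 * (N : ℤ) - 2) : A[T;T⁻¹]ˣ) : A[T;T⁻¹]) * (8 * T 1))) = 8 * (T 1 * Y) := by
    have h1 : ((τ ^ (-((N : ℤ) + 1)) : A[T;T⁻¹]ˣ) : A[T;T⁻¹]) *
        (p ^ (-2 * (N : ℤ) - 2) : A[T;T⁻¹]ˣ) * (p ^ 2 * τ) ^ (N + 1) = 1 := by
      have hu : τ ^ (-((N : ℤ) + 1)) * p ^ (-2 * (N : ℤ) - 2) * (p ^ 2 * τ) ^ (N + 1) = 1 := by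
        rw [mul_pow, ← pow_mul, show -2 * (N : ℤ) - 2 = -((2 * (N + 1) : ℕ) : ℤ) by push_cast; ring,
          show -((N : ℤ) + 1) = -((N + 1 : ℕ) : ℤ) by push_cast; ring, zpow_neg, zpow_neg,
          zpow_natCast, zpow_natCast, mul_assoc, inv_mul_cancel_left, inv_mul_cancel]
      have hu' := congrArg Units.val hu
      simpa only [Units.val_mul, Units.val_pow_eq_pow_val, Units.val_one] using hu'
    rw [← hXp, mul_pow] at h1
    linear_combination (8 * T 1 * Y) * h1 - (4 : A[T;T⁻¹]) ^ (N + 1) *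
      (((τ ^ (-((N : ℤ) + 1)) : A[T;T⁻¹]ˣ) : A[T;T⁻¹]) *
        (((p ^ (-2 * (N : ℤ) - 2) : A[T;T⁻¹]ˣ) : A[T;T⁻¹]) * (8 * T 1))) * hXY
  have hfin := congrArg (fun f : A[T;T⁻¹] => ℓ (f.coeff (-1))) hval
  have hcc (c : ℚ) (f : A[T;T⁻¹]) :
      ℓ ((C (algebraMap ℚ A c) * f).coeff (-1)) = c * ℓ (f.coeff (-1)) := by
    rw [coeff_C_mul, ← Algebra.smul_def, map_smul, smul_eq_mul]
  have h4 := hcc (4 ^ (N + 1)) (((τ ^ (-((N : ℤ) + 1)) : A[T;T⁻¹]ˣ) : A[T;T⁻¹]) *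
      (((p ^ (-2 * (N : ℤ) - 2) : A[T;T⁻¹]ˣ) : A[T;T⁻¹]) * (8 * T 1)))
  have h8' := hcc 8 (T 1 * Y)
  simp only [map_pow, map_ofNat] at h4 h8' hfin
  rw [h4, h8', hres] at hfin
  linarith

end Transfer

section GeneratingFunction

open LaurentPolynomial

lemma one_sub_pow_mul_sum_choose {R : Type*} [CommRing R] {x : R} {K : ℕ} (hx : x ^ (K + 1) = 0)
    (N : ℕ) : (1 - x) ^ (N + 1) * ∑ k ∈ range (K + 1), ((N + k).choose k : R) * x ^ k = 1 := by
  induction N with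
  | zero =>
    simp only [zero_add, pow_one, Nat.choose_self, Nat.cast_one, one_mul]
    rw [mul_neg_geom_sum, hx, sub_zero]
  | succ N ih =>
    have h (L : ℕ) : (1 - x) * ∑ k ∈ range (L + 1), ((N + 1 + k).choose k : R) * x ^ k =
        ∑ k ∈ range (L + 1), ((N + k).choose k : R) * x ^ k -
          ((N + 1 + L).choose L : R) * x ^ (L + 1) := by
      induction L with
      | zero => simp
      | succ L ihL =>
        rw [sum_range_succ, mul_add, ihL, sum_range_succ (n := L + 1)]
        have hc : (N + 1 + (L + 1)).choose (L + 1) =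
            (N + 1 + L).choose L + (N + (L + 1)).choose (L + 1) := by
          rw [show N + 1 + (L + 1) = (N + 1 + L) + 1 by ring, Nat.choose_succ_succ,
            show N + 1 + L = N + (L + 1) by ring]
        rw [hc]
        push_cast
        ring
    rw [pow_succ, mul_assoc, h, hx, mul_zero, sub_zero, ih]

lemma sum_range_two_mul {M : Type*} [AddCommMonoid M] (f : ℕ → M) (m : ℕ) :
    ∑ j ∈ range (2 * m), f j = ∑ d ∈ range m, (f (2 * d) + f (2 * d + 1)) := by
  induction m with
  | zero => simp
  | succ m ih =>
    rw [show 2 * (m + 1) = 2 * m + 1 + 1 by ring, sum_range_succ, sum_range_succ, ih,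
      sum_range_succ, add_assoc]

lemma one_add_T_pow_add_one_sub_T_pow {A : Type*} [CommRing A] {m M : ℕ} (hM : m < 2 * M) :
    (1 + T 1 : A[T;T⁻¹]) ^ m + (1 - T 1) ^ m =
      2 * ∑ d ∈ range M, (C (m.choose (2 * d) : A) * T (2 * d) : A[T;T⁻¹]) := by
  have h (t : A[T;T⁻¹]) : (1 + t) ^ m = ∑ j ∈ range (2 * M), t ^ j * m.choose j := by
    rw [add_comm, add_pow]
    simp only [one_pow, mul_one]
    refine sum_subset (range_mono (by omega)) fun j _ hj => ?_
    rw [Nat.choose_eq_zero_of_lt (by simpa using hj), Nat.cast_zero, mul_zero]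
  rw [sub_eq_add_neg, h, h, ← sum_add_distrib, sum_range_two_mul, mul_sum]
  refine sum_congr rfl fun d _ => ?_
  rw [pow_succ, pow_succ, pow_mul (-T 1 : A[T;T⁻¹]), neg_sq, ← pow_mul, T_pow, map_natCast]
  push_cast
  ring_nf

variable {A ι : Type*} [CommRing A] [Algebra ℚ A] [Fintype ι] [DecidableEq ι]

/-- The Laurent polynomial attached to a block with `m` elements and total weight `b`. -/
noncomputable def blockSeries (M b m : ℕ) : ℚ[T;T⁻¹] :=
  ∑ d ∈ range M, C (((2 * b + 1).choose (2 * d) : ℚ) *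
    ∏ i ∈ Icc 1 (m - 1), ((2 * (d : ℤ) + 1 - 2 * (i : ℤ) : ℤ) : ℚ)) * T (2 * d + 1 - 2 * m)

lemma branch_sq_sub_branch_sq {y : ι → A} (hy : ∀ i, y i * y i = 0) (a : ι → ℕ) {M : ℕ}
    (hM : ∑ i, a i < M) :
    branch y a 1 ^ 2 - branch y a (-1) ^ 2 = 4 * (T 1 + ∑ I : Finset ι with I.Nonempty,
      C (∏ i ∈ I, y i) * ratLaurent A (blockSeries M (∑ i ∈ I, a i) #I)) := by
  rw [branch_sq y hy, branch_sq y hy]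
  have h (I : Finset ι) (hI : I.Nonempty) :
      (halfSquareDeriv A)^[#I - 1]
        (C 1 * T (-1) * (1 + C 1 * T 1) ^ (2 * ∑ i ∈ I, a i + 1)) -
      (halfSquareDeriv A)^[#I - 1]
        (C (-1) * T (-1) * (1 + C (-1) * T 1) ^ (2 * ∑ i ∈ I, a i + 1)) =
      2 * ratLaurent A (blockSeries M (∑ i ∈ I, a i) #I) := by
    have hle : ∑ i ∈ I, a i ≤ ∑ i, a i := sum_le_sum_of_subset (subset_univ I)
    have hits (f : ℕ → A[T;T⁻¹]) (k : ℕ) : (halfSquareDeriv A)^[k] (∑ d ∈ range M, f d) =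
        ∑ d ∈ range M, (halfSquareDeriv A)^[k] (f d) := by
      induction k with
      | zero => rfl
      | succ k ih => simp only [Function.iterate_succ_apply', ih, map_sum]
    rw [← iterate_map_sub]
    have harg : C 1 * T (-1) * (1 + C 1 * T 1) ^ (2 * ∑ i ∈ I, a i + 1) -
        C (-1) * T (-1) * (1 + C (-1) * T 1) ^ (2 * ∑ i ∈ I, a i + 1) =
        ∑ d ∈ range M, (C (2 * ((2 * ∑ i ∈ I, a i + 1).choose (2 * d) : A)) *
          T (2 * d - 1) : A[T;T⁻¹]) := by
      have h2 := one_add_T_pow_add_one_sub_T_pow (A := A)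
        (m := 2 * ∑ i ∈ I, a i + 1) (M := M) (by omega)
      rw [map_neg, map_one, one_mul, one_mul, neg_one_mul, neg_one_mul, neg_mul, sub_neg_eq_add,
        ← mul_add, ← sub_eq_add_neg, h2, mul_sum (range M), mul_sum (range M)]
      refine sum_congr rfl fun d _ => ?_
      rw [sub_eq_add_neg, T_add, map_mul, map_ofNat]
      ring
    rw [harg, hits, blockSeries, map_sum, mul_sum (range M)]
    refine sum_congr rfl fun d _ => ?_
    have hpos := hI.card_pos
    rw [iterate_halfSquareDeriv, ratLaurent_C_mul_T, ← mul_assoc,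
      ← map_ofNat (C : A →+* A[T;T⁻¹]) 2, ← map_mul]
    congr 2
    · rw [map_mul, map_natCast, map_prod, ← mul_assoc]
      congr 1
      refine prod_congr rfl fun i _ => ?_
      push_cast
      simp only [map_ofNat]
      ring
    · push_cast [Nat.cast_sub hpos]
      ring
  have hs : ∑ I : Finset ι with I.Nonempty, C (∏ i ∈ I, y i) * (halfSquareDeriv A)^[#I - 1]
        (C 1 * T (-1) * (1 + C 1 * T 1) ^ (2 * ∑ i ∈ I, a i + 1)) -
      ∑ I : Finset ι with I.Nonempty, C (∏ i ∈ I, y i) * (halfSquareDeriv A)^[#I - 1]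
        (C (-1) * T (-1) * (1 + C (-1) * T 1) ^ (2 * ∑ i ∈ I, a i + 1)) =
      2 * ∑ I : Finset ι with I.Nonempty,
        C (∏ i ∈ I, y i) * ratLaurent A (blockSeries M (∑ i ∈ I, a i) #I) := by
    rw [← sum_sub_distrib, mul_sum]
    refine sum_congr rfl fun I hI => ?_
    rw [← mul_sub, h I (mem_filter.1 hI).2]
    ring
  have h1 : (C (1 : A) : A[T;T⁻¹]) = 1 := map_one _
  have h2 : (C (-1 : A) : A[T;T⁻¹]) = -1 := by rw [map_neg, map_one]
  linear_combination 2 * hs + ((C 1 * T 1 + 2) * T 1 + T 1 ^ 2) * h1 -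
    ((C (-1) * T 1 + 2) * T 1 - T 1 ^ 2) * h2

end GeneratingFunction

section SetPartitions

open LaurentPolynomial

variable {A ι : Type*} [CommRing A] [Algebra ℚ A] [Fintype ι] [DecidableEq ι]

lemma linear_prod_prod_eq_ite {κ : Type*} [Fintype κ] [DecidableEq κ] (ℓ : A →ₗ[ℚ] ℚ) {y : ι → A}
    (hy : ∀ i, y i * y i = 0)
    (hℓ : ∀ I : Finset ι, ℓ (∏ i ∈ I, y i) = if I = univ then 1 else 0) (x : κ → Finset ι) :
    ℓ (∏ j, ∏ i ∈ x j, y i) = if ∀ i, #{j | i ∈ x j} = 1 then 1 else 0 := by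
  have h1 : ∏ j, ∏ i ∈ x j, y i = ∏ i, y i ^ #{j | i ∈ x j} := by
    rw [prod_comm' (t' := univ) (s' := fun i => {j | i ∈ x j}) (by simp)]
    exact prod_congr rfl fun i _ => by rw [prod_const]
  rw [h1]
  by_cases h2 : ∃ i, 2 ≤ #{j | i ∈ x j}
  · obtain ⟨i, hi⟩ := h2
    rw [prod_eq_zero (mem_univ i) (pow_eq_zero_of_le (M₀ := A) hi
      (by rw [pow_two, hy])), map_zero, if_neg]
    exact fun h => by have := h i; omega
  · push Not at h2
    have h3 : ∏ i, y i ^ #{j | i ∈ x j} = ∏ i with #{j | i ∈ x j} = 1, y i := by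
      rw [prod_filter]
      refine prod_congr rfl fun i _ => ?_
      have := h2 i
      split_ifs with h
      · rw [h, pow_one]
      · rw [show #{j | i ∈ x j} = 0 by omega, pow_zero]
    rw [h3, hℓ]
    exact if_congr (by simp [filter_eq_self]) rfl rfl

lemma coeffwise_block_sum_pow (ℓ : A →ₗ[ℚ] ℚ) {y : ι → A} (hy : ∀ i, y i * y i = 0)
    (hℓ : ∀ I : Finset ι, ℓ (∏ i ∈ I, y i) = if I = univ then 1 else 0)
    (ρ : Finset ι → ℚ[T;T⁻¹]) (k : ℕ) :
    coeffwise ℓ ((∑ I : Finset ι with I.Nonempty, C (∏ i ∈ I, y i) * ratLaurent A (ρ I)) ^ k) =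
      ∑ f : ι → Fin k with Function.Surjective f, ∏ j, ρ {i | f i = j} := by
  have h1 : (∑ I : Finset ι with I.Nonempty, C (∏ i ∈ I, y i) * ratLaurent A (ρ I)) ^ k =
      ∑ x ∈ Fintype.piFinset fun _ : Fin k => ({I | I.Nonempty} : Finset (Finset ι)),
        ratLaurent A (∏ j, ρ (x j)) * C (∏ j, ∏ i ∈ x j, y i) := by
    rw [← Fin.prod_const, prod_univ_sum]
    refine sum_congr rfl fun x _ => ?_
    rw [prod_mul_distrib, map_prod, map_prod, mul_comm]
  have h2 (x : Fin k → Finset ι) :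
      coeffwise ℓ (ratLaurent A (∏ j, ρ (x j)) * C (∏ j, ∏ i ∈ x j, y i)) =
        if ∀ i, #{j | i ∈ x j} = 1 then ∏ j, ρ (x j) else 0 := by
    rw [coeffwise_ratLaurent_mul, coeffwise_C, linear_prod_prod_eq_ite ℓ hy hℓ]
    split_ifs <;> simp
  rw [h1, map_sum]
  simp_rw [h2]
  rw [← sum_filter]
  symm
  refine sum_nbij (fun f j => ({i | f i = j} : Finset ι)) ?_ ?_ ?_ fun _ _ => rfl
  · intro f hf
    simp only [mem_filter, mem_univ, true_and, Fintype.mem_piFinset] at hf ⊢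
    refine ⟨fun j => ?_, fun i => ?_⟩
    · obtain ⟨i, hi⟩ := hf j
      exact ⟨i, by simpa using hi⟩
    · rw [card_eq_one]
      exact ⟨f i, by ext; simp [eq_comm]⟩
  · intro f _ f' _ h
    ext i : 1
    have := congrFun h (f i)
    have hi : i ∈ ({i' | f i' = f i} : Finset ι) := by simp
    simp only at this
    rw [this] at hi
    simpa [eq_comm] using hi
  · intro x hx
    simp only [coe_filter, Set.mem_ofPred_eq, Fintype.mem_piFinset, mem_filter, mem_univ,
      true_and] at hx
    have hx2 (i : ι) : ∃ j, ({j | i ∈ x j} : Finset (Fin k)) = {j} := card_eq_one.1 (hx.2 i)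
    choose f hf using hx2
    have hmem (i : ι) (j : Fin k) : i ∈ x j ↔ f i = j := by
      have := congrArg (j ∈ ·) (hf i)
      simpa [eq_comm, iff_comm] using this
    refine ⟨f, ?_, ?_⟩
    · simp only [coe_filter, mem_univ, true_and, Set.mem_ofPred_eq]
      intro j
      obtain ⟨i, hi⟩ := hx.1 j
      exact ⟨i, (hmem i j).1 hi⟩
    · ext j i
      simp [hmem]

lemma coeff_prod_sum_C_mul_T {k : ℕ} (M : ℕ) (c : Fin k → ℕ → ℚ) (e : Fin k → ℕ → ℤ) (m : ℤ) :
    (∏ j, ∑ d ∈ range M, C (c j d) * T (e j d) : ℚ[T;T⁻¹]).coeff m =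
      ∑ d ∈ Fintype.piFinset (fun _ : Fin k => range M) with ∑ j, e j (d j) = m,
        ∏ j, c j (d j) := by
  have hT (s : Fin k → ℤ) : (∏ j, T (s j) : ℚ[T;T⁻¹]) = T (∑ j, s j) := by
    induction (univ : Finset (Fin k)) using Finset.induction_on with
    | empty => simp
    | insert j J hj ih => rw [prod_insert hj, sum_insert hj, ih, T_add]
  rw [prod_univ_sum, sum_filter, AddMonoidAlgebra.coeff_sum, Finsupp.finsetSum_apply]
  refine sum_congr rfl fun d _ => ?_
  rw [prod_mul_distrib, ← map_prod, hT, coeff_C_mul_T]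

/-- A commutative algebra generated by square-zero elements, with the functional reading off the
coefficient of their product. -/
lemma exists_squareZero_algebra (n : ℕ) :
    ∃ (A : Type) (_ : CommRing A) (_ : Algebra ℚ A) (y : Fin n → A) (ℓ : A →ₗ[ℚ] ℚ),
      (∀ i, y i * y i = 0) ∧
      ∀ I : Finset (Fin n), ℓ (∏ i ∈ I, y i) = if I = univ then 1 else 0 := by
  let P := MvPolynomial (Fin n) ℚ
  let s : Set (Fin n →₀ ℕ) := Set.range fun i => Finsupp.single i 2
  let J : Ideal P := Ideal.span ((fun s => MvPolynomial.monomial s (1 : ℚ)) '' s)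
  let u : Fin n →₀ ℕ := Finsupp.equivFunOnFinite.symm fun _ => 1
  have hJ : ∀ p ∈ J, MvPolynomial.coeff u p = 0 := by
    intro p hp
    by_contra h
    obtain ⟨_, ⟨i, rfl⟩, hle⟩ := MvPolynomial.mem_ideal_span_monomial_image.1 hp u
      (MvPolynomial.mem_support_iff.2 h)
    have := hle i
    simp [u] at this
  let ℓ₀ : P ⧸ J →+ ℚ := QuotientAddGroup.lift J.toAddSubgroup
    (MvPolynomial.lcoeff ℚ u).toAddMonoidHom hJ
  refine ⟨P ⧸ J, inferInstance, inferInstance, fun i => Ideal.Quotient.mk J (MvPolynomial.X i),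
    ℓ₀.toRatLinearMap, fun i => ?_, fun I => ?_⟩
  · rw [← map_mul, Ideal.Quotient.eq_zero_iff_mem]
    refine Ideal.subset_span ⟨Finsupp.single i 2, ⟨i, rfl⟩, ?_⟩
    rw [← pow_two, MvPolynomial.X_pow_eq_monomial]
  · rw [← map_prod]
    change MvPolynomial.coeff u (∏ i ∈ I, MvPolynomial.X i) = _
    have hX : (∏ i ∈ I, MvPolynomial.X i : P) =
        MvPolynomial.monomial (∑ i ∈ I, Finsupp.single i 1) 1 :=
      (MvPolynomial.monomial_sum_one _ _).symm
    rw [hX, MvPolynomial.coeff_monomial]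
    refine if_congr ?_ rfl rfl
    rw [Finsupp.ext_iff, eq_univ_iff_forall]
    refine forall_congr' fun i => ?_
    simp [u, Finsupp.finsetSum_apply, Finsupp.single_apply]

end SetPartitions

section GeneratingIdentity

open LaurentPolynomial

/-- The weighted count of ordered set partitions into `k` blocks vanishes after summing over `k`. -/
theorem sum_choose_mul_coeff_eq_zero {ι : Type*} [Fintype ι] [DecidableEq ι] {A : Type*}
    [CommRing A] [Algebra ℚ A] (ℓ : A →ₗ[ℚ] ℚ) {y : ι → A} (hy : ∀ i, y i * y i = 0)
    (hℓ : ∀ I : Finset ι, ℓ (∏ i ∈ I, y i) = if I = univ then 1 else 0) (a : ι → ℕ) (N M : ℕ)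
    (ha : ∑ i, a i = N + Fintype.card ι) (hn : 2 ≤ Fintype.card ι) (hM : ∑ i, a i < M) :
    ∑ k ∈ Icc 1 (Fintype.card ι), (-1 : ℚ) ^ k * ((N + k).choose k : ℚ) *
      ∑ f : ι → Fin k with Function.Surjective f,
        (∏ j, blockSeries M (∑ i with f i = j, a i) #{i | f i = j}).coeff
          ((N : ℤ) + k - 1) = 0 := by
  set F : A[T;T⁻¹] := ∑ I : Finset ι with I.Nonempty,
    C (∏ i ∈ I, y i) * ratLaurent A (blockSeries M (∑ i ∈ I, a i) #I) with hF
  have hnil : IsNilpotent F := by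
    refine isNilpotent_sum fun I hI => ⟨2, ?_⟩
    obtain ⟨i, hi⟩ := (mem_filter.1 hI).2
    rw [mul_pow, ← map_pow, pow_two (∏ i ∈ I, y i), ← prod_mul_distrib, prod_eq_zero hi (hy i),
      map_zero, zero_mul]
  obtain ⟨K₀, hK₀⟩ := hnil
  set K := K₀ + Fintype.card ι with hK
  have hTT : (T 1 : A[T;T⁻¹]) * T (-1) = 1 := by rw [← T_add]; simp
  have hx : (-F * T (-1)) ^ (K + 1) = 0 := by
    rw [mul_pow, neg_pow, pow_eq_zero_of_le (by omega : K₀ ≤ K + 1) hK₀, mul_zero, zero_mul]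
  have hinv := one_sub_pow_mul_sum_choose hx N
  set Y : A[T;T⁻¹] := T (-(N + 1)) *
    ∑ k ∈ range (K + 1), ((N + k).choose k : A[T;T⁻¹]) * (-F * T (-1)) ^ k with hY
  have hXY : (T 1 + F) ^ (N + 1) * Y = 1 := by
    have h1 : T 1 + F = T 1 * (1 - -F * T (-1)) := by linear_combination -F * hTT
    have h2 : (T 1 : A[T;T⁻¹]) ^ (N + 1) * T (-(N + 1)) = 1 := by
      rw [T_pow, ← T_add]
      simp
    rw [h1, mul_pow, hY]
    linear_combination (1 - -F * T (-1)) ^ (N + 1) *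
      (∑ k ∈ range (K + 1), ((N + k).choose k : A[T;T⁻¹]) * (-F * T (-1)) ^ k) * h2 + hinv
  have hres := residue_branch_eq_zero ℓ hy hℓ a N ha hn
    (branch_sq_sub_branch_sq hy a hM).symm hXY
  have hTY : T 1 * Y = ∑ k ∈ range (K + 1),
      C (algebraMap ℚ A ((-1 : ℚ) ^ k * ((N + k).choose k : ℚ))) * (F ^ k * T (-N - k)) := by
    rw [hY, ← mul_assoc, ← T_add, mul_sum]
    refine sum_congr rfl fun k _ => ?_
    rw [show (-N - k : ℤ) = 1 + -(N + 1) + k * (-1) by ring, T_add _ (k * (-1) : ℤ), ← T_pow]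
    simp only [map_mul, map_pow, map_neg, map_one, map_natCast]
    rw [mul_pow, neg_pow]
    ring
  have hcoeff : ℓ ((T 1 * Y : A[T;T⁻¹]).coeff (-1)) =
      ∑ k ∈ range (K + 1), (-1 : ℚ) ^ k * ((N + k).choose k : ℚ) *
        ∑ f : ι → Fin k with Function.Surjective f,
          (∏ j, blockSeries M (∑ i with f i = j, a i) #{i | f i = j}).coeff ((N : ℤ) + k - 1) := by
    rw [hTY, AddMonoidAlgebra.coeff_sum, Finsupp.finsetSum_apply, map_sum]
    refine sum_congr rfl fun k _ => ?_
    rw [coeff_C_mul, ← Algebra.smul_def, map_smul, smul_eq_mul, coeff_mul_T, ← coeff_coeffwise, hF,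
      coeffwise_block_sum_pow ℓ hy hℓ (fun I => blockSeries M (∑ i ∈ I, a i) #I),
      AddMonoidAlgebra.coeff_sum, Finsupp.finsetSum_apply]
    congr 3
    ring_nf
  rw [hcoeff] at hres
  rw [← hres]
  refine sum_subset (fun k hk => ?_) fun k _ hk => ?_
  · simp only [mem_Icc, mem_range] at hk ⊢
    omega
  · rw [filter_eq_empty_iff.2, sum_empty, mul_zero]
    intro f _ hf
    have h1 := Fintype.card_le_of_surjective f hf
    rw [Fintype.card_fin] at h1
    obtain ⟨i⟩ : Nonempty ι := Fintype.card_pos_iff.1 (by omega)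
    have h2 := (f i).pos
    exact hk (mem_Icc.2 ⟨h2, h1⟩)

end GeneratingIdentity

theorem statement0 (g n : ℕ) (hg : 2 ≤ g) (hn : 2 ≤ n) (a : Fin n → ℕ)
    (ha : ∑ i, a i = 2 * g + n - 3) :
    (0 : ℚ) =
      ∑ k ∈ Finset.Icc 1 n,
        ((-1 : ℚ) ^ k * ((2 * g + k - 3).factorial : ℚ) / (k.factorial : ℚ)) *
          ∑ f ∈ Finset.univ.filter fun f : Fin n → Fin k => Function.Surjective f,
            ∑ d ∈ (Fintype.piFinset fun _ : Fin k => Finset.range (g + n - 1)).filter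
                fun d : Fin k → ℕ => ∑ j, d j = g + n - 2,
              ∏ j : Fin k,
                (((2 * (∑ i ∈ Finset.univ.filter fun i : Fin n => f i = j, a i) + 1).choose
                      (2 * d j) : ℚ) *
                  ∏ i ∈ Finset.Icc 1 ((Finset.univ.filter fun i : Fin n => f i = j).card - 1),
                    ((2 * (d j : ℤ) + 1 - 2 * (i : ℤ) : ℤ) : ℚ)) := by
  obtain ⟨A, _, _, y, ℓ, hy, hℓ⟩ := exists_squareZero_algebra n
  obtain ⟨N, hN⟩ : ∃ N, N + 3 = 2 * g := ⟨2 * g - 3, by omega⟩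
  have h := sum_choose_mul_coeff_eq_zero ℓ hy hℓ a N (2 * g + n) (by rw [Fintype.card_fin]; omega)
    (by rwa [Fintype.card_fin]) (by omega)
  rw [Fintype.card_fin] at h
  rw [← mul_zero (N.factorial : ℚ), ← h, mul_sum]
  refine sum_congr rfl fun k _ => ?_
  have hfac : (-1 : ℚ) ^ k * ((2 * g + k - 3).factorial : ℚ) / (k.factorial : ℚ) =
      N.factorial * ((-1 : ℚ) ^ k * ((N + k).choose k : ℚ)) := by
    have h1 : ((N + k).choose k * N.factorial * k.factorial : ℚ) = (N + k).factorial := by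
      exact_mod_cast Nat.add_choose_mul_factorial_mul_factorial N k
    have hk : (k.factorial : ℚ) ≠ 0 := by positivity
    rw [show 2 * g + k - 3 = N + k by omega, ← h1]
    field_simp
  rw [hfac, ← mul_assoc]
  congr 1
  refine sum_congr rfl fun f _ => ?_
  unfold blockSeries
  rw [coeff_prod_sum_C_mul_T]
  refine sum_congr ?_ fun _ _ => rfl
  have hcard : ∑ j, #{i | f i = j} = n := by
    rw [sum_card_fiberwise_eq_card_filter]; simp
  have hexp (d : Fin k → ℕ) :
      ∑ j, (2 * (d j : ℤ) + 1 - 2 * (#{i | f i = j} : ℕ)) = N + k - 1 ↔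
        ∑ j, d j = g + n - 2 := by
    have h1 : ∑ j, (2 * (d j : ℤ) + 1 - 2 * (#{i | f i = j} : ℕ)) =
        2 * ((∑ j, d j : ℕ) : ℤ) + k - 2 * n := by
      rw [sum_sub_distrib, sum_add_distrib, ← mul_sum, ← mul_sum, ← Nat.cast_sum, ← Nat.cast_sum,
        hcard]
      simp
    rw [h1]
    omega
  ext d
  simp only [mem_filter, Fintype.mem_piFinset, mem_range, hexp]
  refine and_congr_left fun hd => ?_
  have hle (j : Fin k) : d j ≤ g + n - 2 :=
    hd ▸ single_le_sum (fun _ _ => Nat.zero_le _) (mem_univ j)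
  exact ⟨fun _ j => by have := hle j; omega, fun _ j => by have := hle j; omega⟩
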